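/- arXiv:2002.02266 — 3 statements merged into one kernel-verified Lean document; each statement's English description precedes it below -/
import Mathlib

section
/- There exist constants C>0 and h_0>0, depending only on k, α, β, γ, b-a and the quasi-uniformity constant c, such that whenever h ≤ h_0, u is (k+1)-times continuously differentiable with u(a)=u(b)=0, f := -αu''+βu'+γu, u_h is a Petrov–Galerkin solution and u_I is the truncated Jacobi projection of u, then: ‖u_h-u_I‖_2 ≤ C h^{k} |u|_{k+1,∞}; and if moreover β=0 and γ≠0, then ‖u_h-u_I‖_2 ≤ C h^{k+1} |u|_{k+1,∞}. -/
open Set Finset intervalIntegral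

/-- The Legendre polynomial of degree `n` (Rodrigues formula), as a real function. -/
noncomputable def legendre (n : ℕ) : ℝ → ℝ :=
  fun s => (1 / ((2 : ℝ) ^ n * n.factorial)) * iteratedDeriv n (fun t : ℝ => (t ^ 2 - 1) ^ n) s

/-- The affine map sending `[-1,1]` onto `[p,q]`. -/
noncomputable def affMap (p q s : ℝ) : ℝ := (p + q) / 2 + s * (q - p) / 2

/-- `x 0 = a < x 1 < ... < x N = b` is a partition of `[a,b]`. -/
def IsMesh (a b : ℝ) (N : ℕ) (x : ℕ → ℝ) : Prop :=
  1 ≤ N ∧ x 0 = a ∧ x N = b ∧ ∀ i < N, x i < x (i + 1)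

/-- `h` is the maximal element length `h = max_i (x i - x (i-1))`. -/
def IsMeshSize (N : ℕ) (x : ℕ → ℝ) (h : ℝ) : Prop :=
  (∀ i ∈ Finset.Icc 1 N, x i - x (i - 1) ≤ h) ∧ ∃ i ∈ Finset.Icc 1 N, x i - x (i - 1) = h

/-- Quasi-uniformity with constant `c`: `h ≤ c · h_i` for all elements. -/
def IsQuasiUniform (N : ℕ) (x : ℕ → ℝ) (h c : ℝ) : Prop :=
  ∀ i ∈ Finset.Icc 1 N, h ≤ c * (x i - x (i - 1))

/-- `P i` are the element polynomials (degree ≤ k) of a member of `V_h^0`: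
a C¹ piecewise polynomial vanishing at both ends of `[a,b]`. -/
def IsVh0 (k N : ℕ) (x : ℕ → ℝ) (P : ℕ → Polynomial ℝ) : Prop :=
  (∀ i ∈ Finset.Icc 1 N, (P i).natDegree ≤ k) ∧
  (∀ i ∈ Finset.Icc 1 (N - 1), (P i).eval (x i) = (P (i + 1)).eval (x i)) ∧
  (∀ i ∈ Finset.Icc 1 (N - 1),
      (Polynomial.derivative (P i)).eval (x i) = (Polynomial.derivative (P (i + 1))).eval (x i)) ∧
  (P 1).eval (x 0) = 0 ∧ (P N).eval (x N) = 0

/-- `P i` are the element polynomials of a Petrov–Galerkin solution `u_h ∈ V_h^0`: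
`∑_i ∫_{τ_i} (-α u_h'' + β u_h' + γ u_h) v_h = ∫_a^b f v_h` for all `v_h ∈ W_h`. -/
def IsPGSol (k N : ℕ) (x : ℕ → ℝ) (α β γ : ℝ) (f : ℝ → ℝ) (P : ℕ → Polynomial ℝ) : Prop :=
  IsVh0 k N x P ∧
  ∀ Q : ℕ → Polynomial ℝ, (∀ i ∈ Finset.Icc 1 N, (Q i).natDegree ≤ k - 2) →
    (∑ i ∈ Finset.Icc 1 N, ∫ t in (x (i - 1))..(x i),
        (-α * ((Polynomial.derivative (Polynomial.derivative (P i))).eval t)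
            + β * ((Polynomial.derivative (P i)).eval t) + γ * (P i).eval t) * (Q i).eval t)
      = ∑ i ∈ Finset.Icc 1 N, ∫ t in (x (i - 1))..(x i), f t * (Q i).eval t

/-- `P i` are the element polynomials of a Gauss collocation solution `ū_h ∈ V_h^0`:
`(-α ū_h'' + β ū_h' + γ ū_h)(g) = f(g)` at every Gauss point `g` of every element. -/
def IsGaussSol (k N : ℕ) (x : ℕ → ℝ) (α β γ : ℝ) (f : ℝ → ℝ) (P : ℕ → Polynomial ℝ) : Prop :=
  IsVh0 k N x P ∧
  ∀ i ∈ Finset.Icc 1 N, ∀ s ∈ Set.Ioo (-1 : ℝ) 1, legendre (k - 1) s = 0 →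
    -α * ((Polynomial.derivative (Polynomial.derivative (P i))).eval (affMap (x (i - 1)) (x i) s))
        + β * ((Polynomial.derivative (P i)).eval (affMap (x (i - 1)) (x i) s))
        + γ * (P i).eval (affMap (x (i - 1)) (x i) s)
      = f (affMap (x (i - 1)) (x i) s)

/-- `p` is the elementwise truncated Jacobi projection of `u` on the element `[xl, xr]`:
the polynomial of degree ≤ k matching `u` and `u'` at both endpoints with
`(u - p)'' ⊥ P_{k-2}` in `L²(xl, xr)`. -/
def IsElemProj (k : ℕ) (u : ℝ → ℝ) (xl xr : ℝ) (p : Polynomial ℝ) : Prop :=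
  p.natDegree ≤ k ∧ p.eval xl = u xl ∧ p.eval xr = u xr ∧
  (Polynomial.derivative p).eval xl = deriv u xl ∧
  (Polynomial.derivative p).eval xr = deriv u xr ∧
  ∀ q : Polynomial ℝ, q.natDegree ≤ k - 2 →
    (∫ t in xl..xr,
        (iteratedDeriv 2 u t - (Polynomial.derivative (Polynomial.derivative p)).eval t)
          * q.eval t) = 0

/-- The sum over the elements of a mesh of the integrals of a family of element functions. -/
noncomputable def meshIntegral (N : ℕ) (x : ℕ → ℝ) (F : ℕ → ℝ → ℝ) : ℝ :=
  ∑ i ∈ Finset.Icc 1 N, ∫ t in (x (i - 1))..(x i), F i t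

section MeshIntegral

variable {N : ℕ} {x : ℕ → ℝ} {a b : ℝ}

lemma meshIntegral_add {F G : ℕ → ℝ → ℝ} (hF : ∀ i, Continuous (F i))
    (hG : ∀ i, Continuous (G i)) :
    meshIntegral N x (fun i t => F i t + G i t) = meshIntegral N x F + meshIntegral N x G := by
  unfold meshIntegral
  rw [← Finset.sum_add_distrib]
  refine Finset.sum_congr rfl fun i _ => ?_
  exact intervalIntegral.integral_add ((hF i).intervalIntegrable _ _)
    ((hG i).intervalIntegrable _ _)

lemma meshIntegral_const_mul (r : ℝ) (F : ℕ → ℝ → ℝ) :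
    meshIntegral N x (fun i t => r * F i t) = r * meshIntegral N x F := by
  unfold meshIntegral
  rw [Finset.mul_sum]
  exact Finset.sum_congr rfl fun i _ => intervalIntegral.integral_const_mul _ _

lemma meshIntegral_congr {F G : ℕ → ℝ → ℝ} (hFG : ∀ i t, F i t = G i t) :
    meshIntegral N x F = meshIntegral N x G := by
  congr 1
  ext i t
  exact hFG i t

lemma IsMesh.prev_lt (hx : IsMesh a b N x) {i : ℕ} (hi : i ∈ Finset.Icc 1 N) :
    x (i - 1) < x i := by
  obtain ⟨h1, h2⟩ := Finset.mem_Icc.1 hi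
  have := hx.2.2.2 (i - 1) (by omega)
  rwa [Nat.sub_add_cancel h1] at this

lemma IsMesh.le_node (hx : IsMesh a b N x) {i : ℕ} (hi : i ≤ N) : a ≤ x i := by
  induction i with
  | zero => exact hx.2.1.ge
  | succ n ih => exact (ih (by omega)).trans (hx.2.2.2 n (by omega)).le

lemma IsMesh.node_le (hx : IsMesh a b N x) {i : ℕ} (hi : i ≤ N) : x i ≤ b := by
  induction hi using Nat.decreasingInduction with
  | self => exact hx.2.2.1.le
  | of_succ n hn ih => exact (hx.2.2.2 n hn).le.trans ih

lemma IsMesh.mem_Icc (hx : IsMesh a b N x) {i : ℕ} (hi : i ∈ Finset.Icc 1 N) {t : ℝ}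
    (ht : t ∈ Set.Icc (x (i - 1)) (x i)) : t ∈ Set.Icc a b := by
  obtain ⟨h1, h2⟩ := Finset.mem_Icc.1 hi
  exact ⟨(hx.le_node (by omega)).trans ht.1, ht.2.trans (hx.node_le h2)⟩

lemma meshIntegral_mono (hx : IsMesh a b N x) {F G : ℕ → ℝ → ℝ}
    (hF : ∀ i, Continuous (F i)) (hG : ∀ i, Continuous (G i))
    (hFG : ∀ i, ∀ t ∈ Set.Icc a b, F i t ≤ G i t) :
    meshIntegral N x F ≤ meshIntegral N x G := by
  refine Finset.sum_le_sum fun i hi => ?_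
  exact intervalIntegral.integral_mono_on (hx.prev_lt hi).le ((hF i).intervalIntegrable _ _)
    ((hG i).intervalIntegrable _ _) fun t ht => hFG i t (hx.mem_Icc hi ht)

lemma meshIntegral_nonneg (hx : IsMesh a b N x) {F : ℕ → ℝ → ℝ} (hF : ∀ i t, 0 ≤ F i t) :
    0 ≤ meshIntegral N x F :=
  Finset.sum_nonneg fun i hi =>
    intervalIntegral.integral_nonneg (hx.prev_lt hi).le fun t _ => hF i t

/-- Linear domination of one integrand by three others. -/
lemma meshIntegral_le_linear (hx : IsMesh a b N x) {F G₁ G₂ G₃ : ℕ → ℝ → ℝ} (r₁ r₂ r₃ : ℝ)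
    (hF : ∀ i, Continuous (F i)) (h₁ : ∀ i, Continuous (G₁ i)) (h₂ : ∀ i, Continuous (G₂ i))
    (h₃ : ∀ i, Continuous (G₃ i))
    (hFG : ∀ i, ∀ t ∈ Set.Icc a b, F i t ≤ r₁ * G₁ i t + r₂ * G₂ i t + r₃ * G₃ i t) :
    meshIntegral N x F ≤
      r₁ * meshIntegral N x G₁ + r₂ * meshIntegral N x G₂ + r₃ * meshIntegral N x G₃ := by
  have key := meshIntegral_mono hx (G := fun i t => r₁ * G₁ i t + r₂ * G₂ i t + r₃ * G₃ i t) hF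
    (fun i => (((h₁ i).const_mul r₁).add ((h₂ i).const_mul r₂)).add ((h₃ i).const_mul r₃)) hFG
  rw [meshIntegral_add
    (F := fun i t => r₁ * G₁ i t + r₂ * G₂ i t)
    (fun i => ((h₁ i).const_mul r₁).add ((h₂ i).const_mul r₂)) (fun i => (h₃ i).const_mul r₃),
    meshIntegral_add (fun i => (h₁ i).const_mul r₁) (fun i => (h₂ i).const_mul r₂),
    meshIntegral_const_mul, meshIntegral_const_mul, meshIntegral_const_mul] at key
  exact key

/-- Fundamental theorem of calculus for a globally continuous family of element functions. -/
lemma meshIntegral_deriv (hN : 1 ≤ N) {Φ φ : ℕ → ℝ → ℝ}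
    (hΦ : ∀ i t, HasDerivAt (Φ i) (φ i t) t) (hφ : ∀ i, Continuous (φ i))
    (hglue : ∀ i ∈ Finset.Icc 1 (N - 1), Φ i (x i) = Φ (i + 1) (x i)) :
    meshIntegral N x φ = Φ N (x N) - Φ 1 (x 0) := by
  have hint : ∀ i, ∫ t in (x (i - 1))..(x i), φ i t = Φ i (x i) - Φ i (x (i - 1)) := fun i =>
    intervalIntegral.integral_eq_sub_of_hasDerivAt (fun t _ => hΦ i t)
      ((hφ i).intervalIntegrable _ _)
  induction N, hN using Nat.le_induction with
  | base => simp [meshIntegral, hint]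
  | succ n hn ih =>
    have hih := ih fun i hi => hglue i (by simp only [Finset.mem_Icc] at hi ⊢; omega)
    have hg := hglue n (by simp only [Finset.mem_Icc]; omega)
    unfold meshIntegral at hih ⊢
    rw [Finset.sum_Icc_succ_top (by omega), hih, hint, Nat.add_sub_cancel, hg]
    ring

end MeshIntegral

/-- A Poincaré inequality for functions vanishing at the left endpoint. -/
lemma integral_sq_le_of_eq_zero_left {l r : ℝ} (hlr : l ≤ r) {w w' : ℝ → ℝ}
    (hw : ∀ t, HasDerivAt w (w' t) t) (hw' : Continuous w') (h0 : w l = 0) :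
    ∫ t in l..r, w t ^ 2 ≤ 4 * (r - l) ^ 2 * ∫ t in l..r, w' t ^ 2 := by
  have hwc : Continuous w := continuous_iff_continuousAt.2 fun t => (hw t).continuousAt
  have hder : ∀ t, HasDerivAt (fun t => (t - r) * w t ^ 2)
      (w t ^ 2 + 2 * (t - r) * w t * w' t) t := fun t =>
    (((hasDerivAt_id' t).sub_const r).mul ((hw t).pow 2)).congr_deriv (by norm_num; ring)
  have hzero : ∫ t in l..r, (w t ^ 2 + 2 * (t - r) * w t * w' t) = 0 := by
    rw [intervalIntegral.integral_eq_sub_of_hasDerivAt (fun t _ => hder t)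
      (by apply Continuous.intervalIntegrable; fun_prop)]
    simp [h0]
  calc ∫ t in l..r, w t ^ 2
      ≤ ∫ t in l..r, (2 * (w t ^ 2 + 2 * (t - r) * w t * w' t)
          + 4 * (r - l) ^ 2 * w' t ^ 2) := by
        refine intervalIntegral.integral_mono_on hlr
          (by apply Continuous.intervalIntegrable; fun_prop)
          (by apply Continuous.intervalIntegrable; fun_prop) fun t ht => ?_
        have h1 : (t - r) ^ 2 ≤ (r - l) ^ 2 := by nlinarith [ht.1, ht.2]
        nlinarith [sq_nonneg (w t + 2 * (t - r) * w' t),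
          mul_le_mul_of_nonneg_right h1 (sq_nonneg (w' t))]
    _ = 4 * (r - l) ^ 2 * ∫ t in l..r, w' t ^ 2 := by
        rw [intervalIntegral.integral_add (by apply Continuous.intervalIntegrable; fun_prop)
          (by apply Continuous.intervalIntegrable; fun_prop),
          intervalIntegral.integral_const_mul, intervalIntegral.integral_const_mul, hzero]
        ring

lemma meshIntegral_sq_le_of_eq_zero_left {N : ℕ} {x : ℕ → ℝ} {a b h : ℝ}
    (hx : IsMesh a b N x) (hh : IsMeshSize N x h) {w w' : ℕ → ℝ → ℝ}
    (hw : ∀ i t, HasDerivAt (w i) (w' i t) t) (hw' : ∀ i, Continuous (w' i))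
    (h0 : ∀ i ∈ Finset.Icc 1 N, w i (x (i - 1)) = 0) :
    meshIntegral N x (fun i t => w i t ^ 2)
      ≤ 4 * h ^ 2 * meshIntegral N x (fun i t => w' i t ^ 2) := by
  unfold meshIntegral
  rw [Finset.mul_sum]
  refine Finset.sum_le_sum fun i hi => ?_
  have hlt := hx.prev_lt hi
  refine (integral_sq_le_of_eq_zero_left hlt.le (hw i) (hw' i) (h0 i hi)).trans ?_
  refine mul_le_mul_of_nonneg_right ?_
    (intervalIntegral.integral_nonneg hlt.le fun t _ => sq_nonneg _)
  have h1 := hh.1 i hi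
  nlinarith

/-- Taylor approximation by a polynomial on an interval. -/
lemma exists_polynomial_taylor_bound {f : ℝ → ℝ} {n : ℕ} (hf : ContDiff ℝ (n + 1 : ℕ) f)
    {l r M : ℝ} (hlr : l < r) (hM : ∀ y ∈ Set.Icc l r, |iteratedDeriv (n + 1) f y| ≤ M) :
    ∃ T : Polynomial ℝ, T.natDegree ≤ n ∧
      ∀ t ∈ Set.Icc l r, |f t - T.eval t| ≤ M * (r - l) ^ (n + 1) := by
  refine ⟨∑ j ∈ Finset.range (n + 1), Polynomial.C ((j.factorial : ℝ)⁻¹ *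
      iteratedDerivWithin j f (Set.Icc l r) l) * (Polynomial.X - Polynomial.C l) ^ j, ?_, ?_⟩
  · refine Polynomial.natDegree_sum_le_of_forall_le _ _ fun j hj => ?_
    refine (Polynomial.natDegree_C_mul_le _ _).trans ?_
    rw [Polynomial.natDegree_pow, Polynomial.natDegree_X_sub_C]
    have := Finset.mem_range.1 hj
    omega
  · intro t ht
    have hM0 : 0 ≤ M := (abs_nonneg _).trans (hM t ht)
    have key := taylor_mean_remainder_bound (f := f) (n := n) (C := M) hlr.le
      (by exact_mod_cast hf.contDiffOn) ht (fun y hy => by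
        rw [iteratedDerivWithin_eq_iteratedDeriv (uniqueDiffOn_Icc hlr) hf.contDiffAt hy]
        exact hM y hy)
    rw [taylor_within_apply] at key
    have heval : (∑ j ∈ Finset.range (n + 1), Polynomial.C ((j.factorial : ℝ)⁻¹ *
      iteratedDerivWithin j f (Set.Icc l r) l) * (Polynomial.X - Polynomial.C l) ^ j).eval t
      = ∑ j ∈ Finset.range (n + 1), ((j.factorial : ℝ)⁻¹ * (t - l) ^ j) •
        iteratedDerivWithin j f (Set.Icc l r) l := by
      rw [Polynomial.eval_finsetSum]
      refine Finset.sum_congr rfl fun j _ => ?_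
      simp only [Polynomial.eval_mul, Polynomial.eval_C, Polynomial.eval_pow, Polynomial.eval_sub,
        Polynomial.eval_X, smul_eq_mul]
      ring
    rw [heval]
    refine key.trans ?_
    have h1 : (t - l) ^ (n + 1) ≤ (r - l) ^ (n + 1) :=
      pow_le_pow_left₀ (by linarith [ht.1]) (by linarith [ht.2]) _
    have h2 : (1 : ℝ) ≤ n.factorial := by exact_mod_cast n.factorial_pos
    have h3 : 0 ≤ M * (t - l) ^ (n + 1) := by
      have := ht.1
      have : 0 ≤ t - l := by linarith
      positivity
    exact (div_le_self h3 h2).trans (mul_le_mul_of_nonneg_left h1 hM0)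

/-- An `L²`-projection onto polynomials is a best approximation, up to a constant. -/
lemma integral_sq_sub_le_of_orthogonal {f : ℝ → ℝ} (hf : Continuous f) {l r K : ℝ} (hlr : l ≤ r)
    {n : ℕ} {q T : Polynomial ℝ} (hq : q.natDegree ≤ n) (hT : T.natDegree ≤ n)
    (horth : ∀ v : Polynomial ℝ, v.natDegree ≤ n → ∫ t in l..r, (f t - q.eval t) * v.eval t = 0)
    (hK : ∀ t ∈ Set.Icc l r, |f t - T.eval t| ≤ K) :
    ∫ t in l..r, (f t - q.eval t) ^ 2 ≤ (r - l) * K ^ 2 := by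
  have h0 := horth (T - q) ((Polynomial.natDegree_sub_le _ _).trans (max_le hT hq))
  calc ∫ t in l..r, (f t - q.eval t) ^ 2
      ≤ ∫ t in l..r, (2 * ((f t - q.eval t) * (T - q).eval t) + K ^ 2) := by
        refine intervalIntegral.integral_mono_on hlr
          (by apply Continuous.intervalIntegrable; fun_prop)
          (by apply Continuous.intervalIntegrable; fun_prop) fun t ht => ?_
        have h1 := sq_le_sq' (abs_le.1 (hK t ht)).1 (abs_le.1 (hK t ht)).2
        rw [Polynomial.eval_sub]
        nlinarith [sq_nonneg (T.eval t - q.eval t)]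
    _ = (r - l) * K ^ 2 := by
        rw [intervalIntegral.integral_add (by apply Continuous.intervalIntegrable; fun_prop)
          (by apply Continuous.intervalIntegrable; fun_prop),
          intervalIntegral.integral_const_mul, h0]
        simp

lemma meshIntegral_const {N : ℕ} {x : ℕ → ℝ} {a b : ℝ} (hx : IsMesh a b N x) (K : ℝ) :
    meshIntegral N x (fun _ _ => K) = K * (b - a) := by
  rw [meshIntegral_deriv (Φ := fun _ t => K * t) hx.1
    (fun _ t => by simpa using (hasDerivAt_id' t).const_mul K) (fun _ => continuous_const)
    (fun _ _ => rfl), hx.2.1, hx.2.2.1]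
  ring

/-- The second derivative of the truncated Jacobi projection approximates that of `u`. -/
lemma meshIntegral_projection_error {k : ℕ} (hk : 2 ≤ k) {N : ℕ} {x : ℕ → ℝ} {a b h : ℝ}
    (hx : IsMesh a b N x) (hh : IsMeshSize N x h) {u : ℝ → ℝ} (hu : ContDiff ℝ (k + 1) u)
    {p : ℕ → Polynomial ℝ}
    (hp : ∀ i ∈ Finset.Icc 1 N, IsElemProj k u (x (i - 1)) (x i) (p i)) {M : ℝ}
    (hM : ∀ y ∈ Set.Icc a b, |iteratedDeriv (k + 1) u y| ≤ M) :
    meshIntegral N x (fun i t => (iteratedDeriv 2 u t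
        - (Polynomial.derivative (Polynomial.derivative (p i))).eval t) ^ 2)
      ≤ (M * h ^ (k - 1)) ^ 2 * (b - a) := by
  obtain ⟨n, rfl⟩ : ∃ n, k = n + 2 := ⟨k - 2, by omega⟩
  have hu2 : ContDiff ℝ (n + 1 : ℕ) (iteratedDeriv 2 u) := by
    rw [iteratedDeriv_eq_iterate]
    refine ContDiff.iterate_deriv' (n + 1) 2 (hu.of_le ?_)
    norm_cast
  have hiter : iteratedDeriv (n + 1) (iteratedDeriv 2 u) = iteratedDeriv (n + 2 + 1) u := by
    simp only [iteratedDeriv_eq_iterate, ← Function.iterate_add_apply]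
  rw [← meshIntegral_const hx]
  refine Finset.sum_le_sum fun i hi => ?_
  have hlt := hx.prev_lt hi
  obtain ⟨T, hTdeg, hT⟩ := exists_polynomial_taylor_bound hu2 hlt (M := M) fun y hy => by
    rw [hiter]
    exact hM y (hx.mem_Icc hi hy)
  obtain ⟨hdeg, -, -, -, -, horth⟩ := hp i hi
  have hd2 : (Polynomial.derivative (Polynomial.derivative (p i))).natDegree ≤ n := by
    have h1 := Polynomial.natDegree_derivative_le (p i)
    have h2 := Polynomial.natDegree_derivative_le (Polynomial.derivative (p i))
    omega
  have hM0 : 0 ≤ M := (abs_nonneg _).trans (hM _ (hx.mem_Icc hi ⟨hlt.le, le_rfl⟩))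
  have key := integral_sq_sub_le_of_orthogonal hu2.continuous hlt.le hd2 hTdeg
    (fun v hv => horth v (by simpa using hv)) (K := M * h ^ (n + 1)) fun t ht => by
      refine (hT t ht).trans (mul_le_mul_of_nonneg_left ?_ hM0)
      exact pow_le_pow_left₀ (by linarith) (hh.1 i hi) _
  rw [intervalIntegral.integral_const, smul_eq_mul]
  exact key

section Stability

variable {k N : ℕ} {x : ℕ → ℝ} {a b h α β γ : ℝ} {E : ℕ → Polynomial ℝ}

/-- A Poincaré inequality on the trial space. -/
lemma IsVh0.meshIntegral_sq_le (hx : IsMesh a b N x) (hE : IsVh0 k N x E) :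
    meshIntegral N x (fun i t => (E i).eval t ^ 2) ≤
      4 * (b - a) ^ 2 * meshIntegral N x (fun i t => (E i).derivative.eval t ^ 2) := by
  obtain ⟨-, hglue, -, hl, hr⟩ := hE
  have hzero : meshIntegral N x (fun i t => (E i).eval t ^ 2
      + 2 * (t - a) * (E i).eval t * (E i).derivative.eval t) = 0 := by
    rw [meshIntegral_deriv (Φ := fun i t => (t - a) * (E i).eval t ^ 2) hx.1
      (fun i t => (((hasDerivAt_id' t).sub_const a).mul
        (((E i).hasDerivAt t).pow 2)).congr_deriv (by norm_num; ring))
      (fun i => by fun_prop) (fun i hi => by simp only [hglue i hi])]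
    simp [hl, hr]
  have key := meshIntegral_le_linear hx 2 (4 * (b - a) ^ 2) 0
    (F := fun i t => (E i).eval t ^ 2)
    (G₁ := fun i t => (E i).eval t ^ 2
      + 2 * (t - a) * (E i).eval t * (E i).derivative.eval t)
    (G₂ := fun i t => (E i).derivative.eval t ^ 2) (G₃ := fun _ _ => 0)
    (fun i => by fun_prop) (fun i => by fun_prop) (fun i => by fun_prop) (fun i => by fun_prop)
    fun i t ht => by
      have h1 : (t - a) ^ 2 ≤ (b - a) ^ 2 := by nlinarith [ht.1, ht.2]
      nlinarith [sq_nonneg ((E i).eval t + 2 * (t - a) * (E i).derivative.eval t),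
        mul_le_mul_of_nonneg_right h1 (sq_nonneg ((E i).derivative.eval t))]
  rw [hzero] at key
  linarith

/-- The energy estimate for the differential operator on the trial space. -/
lemma IsVh0.meshIntegral_deriv_sq_le (hα : 0 < α) (hγ : 0 ≤ γ) (hab : a < b)
    (hx : IsMesh a b N x) (hE : IsVh0 k N x E) :
    meshIntegral N x (fun i t => (E i).derivative.eval t ^ 2) ≤
      4 * (b - a) ^ 2 / α ^ 2 * meshIntegral N x (fun i t =>
        (-α * (E i).derivative.derivative.eval t + β * (E i).derivative.eval t
          + γ * (E i).eval t) ^ 2) := by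
  have hP := hE.meshIntegral_sq_le hx
  obtain ⟨-, hglue, hglue', hl, hr⟩ := hE
  have hd : 0 < b - a := sub_pos.2 hab
  have hzero : meshIntegral N x (fun i t => -α * ((E i).derivative.derivative.eval t
      * (E i).eval t + (E i).derivative.eval t ^ 2)
      + β * ((E i).derivative.eval t * (E i).eval t)) = 0 := by
    rw [meshIntegral_deriv (Φ := fun i t => -α * ((E i).derivative.eval t * (E i).eval t)
        + β / 2 * (E i).eval t ^ 2) hx.1
      (fun i t => (((((E i).derivative.hasDerivAt t).mul ((E i).hasDerivAt t)).const_mul (-α)).add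
        ((((E i).hasDerivAt t).pow 2).const_mul (β / 2))).congr_deriv (by norm_num; ring))
      (fun i => by fun_prop) (fun i hi => by simp only [hglue i hi, hglue' i hi])]
    simp [hl, hr]
  have key := meshIntegral_le_linear hx (2 * (b - a) ^ 2 / α ^ 2) (1 / (8 * (b - a) ^ 2)) (-1 / α)
    (F := fun i t => (E i).derivative.eval t ^ 2)
    (G₁ := fun i t => (-α * (E i).derivative.derivative.eval t + β * (E i).derivative.eval t
          + γ * (E i).eval t) ^ 2)
    (G₂ := fun i t => (E i).eval t ^ 2)
    (G₃ := fun i t => -α * ((E i).derivative.derivative.eval t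
      * (E i).eval t + (E i).derivative.eval t ^ 2)
      + β * ((E i).derivative.eval t * (E i).eval t))
    (fun i => by fun_prop) (fun i => by fun_prop) (fun i => by fun_prop) (fun i => by fun_prop)
    fun i t _ => by
      generalize (E i).derivative.derivative.eval t = e2
      generalize (E i).derivative.eval t = e1
      generalize (E i).eval t = e0
      have h1 : 0 ≤ 2 * ((b - a) / α * (-α * e2 + β * e1 + γ * e0) - e0 / (4 * (b - a))) ^ 2
          + γ / α * e0 ^ 2 := by positivity
      have h2 : 2 * (b - a) ^ 2 / α ^ 2 * (-α * e2 + β * e1 + γ * e0) ^ 2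
          + 1 / (8 * (b - a) ^ 2) * e0 ^ 2
          + -1 / α * (-α * (e2 * e0 + e1 ^ 2) + β * (e1 * e0)) - e1 ^ 2
        = 2 * ((b - a) / α * (-α * e2 + β * e1 + γ * e0) - e0 / (4 * (b - a))) ^ 2
          + γ / α * e0 ^ 2 := by
        field_simp
        ring
      linarith
  rw [hzero] at key
  have h3 := mul_le_mul_of_nonneg_left hP (show 0 ≤ 1 / (8 * (b - a) ^ 2) by positivity)
  rw [← mul_assoc, show 1 / (8 * (b - a) ^ 2) * (4 * (b - a) ^ 2) = (1 / 2 : ℝ) by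
    field_simp; norm_num] at h3
  have h4 : 4 * (b - a) ^ 2 / α ^ 2 = 2 * (2 * (b - a) ^ 2 / α ^ 2) := by ring
  rw [h4]
  linarith

/-- The `H²` stability of the differential operator on the trial space. -/
lemma IsVh0.meshIntegral_H2_le (hα : 0 < α) (hγ : 0 ≤ γ) (hab : a < b)
    (hx : IsMesh a b N x) (hE : IsVh0 k N x E) :
    meshIntegral N x (fun i t => (E i).eval t ^ 2 + (E i).derivative.eval t ^ 2
        + (E i).derivative.derivative.eval t ^ 2) ≤
      (3 / α ^ 2 + (1 + 3 * β ^ 2 / α ^ 2 + (1 + 3 * γ ^ 2 / α ^ 2) * (4 * (b - a) ^ 2))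
          * (4 * (b - a) ^ 2 / α ^ 2))
        * meshIntegral N x (fun i t =>
        (-α * (E i).derivative.derivative.eval t + β * (E i).derivative.eval t
          + γ * (E i).eval t) ^ 2) := by
  have h0 := hE.meshIntegral_sq_le hx
  have h1 := hE.meshIntegral_deriv_sq_le (β := β) hα hγ hab hx
  have key := meshIntegral_le_linear hx (3 / α ^ 2) (1 + 3 * β ^ 2 / α ^ 2)
    (1 + 3 * γ ^ 2 / α ^ 2)
    (F := fun i t => (E i).eval t ^ 2 + (E i).derivative.eval t ^ 2
        + (E i).derivative.derivative.eval t ^ 2)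
    (G₁ := fun i t => (-α * (E i).derivative.derivative.eval t + β * (E i).derivative.eval t
          + γ * (E i).eval t) ^ 2)
    (G₂ := fun i t => (E i).derivative.eval t ^ 2)
    (G₃ := fun i t => (E i).eval t ^ 2)
    (fun i => by fun_prop) (fun i => by fun_prop) (fun i => by fun_prop) (fun i => by fun_prop)
    fun i t _ => by
      generalize (E i).derivative.derivative.eval t = e2
      generalize (E i).derivative.eval t = e1
      generalize (E i).eval t = e0
      set L := -α * e2 + β * e1 + γ * e0 with hL
      have h2 : e2 = (β * e1 + γ * e0 - L) / α := by
        rw [hL]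
        field_simp
        ring
      have h3 : (β * e1 + γ * e0 - L) ^ 2 ≤ 3 * (L ^ 2 + (β * e1) ^ 2 + (γ * e0) ^ 2) := by
        nlinarith [sq_nonneg (β * e1 - γ * e0), sq_nonneg (β * e1 + L), sq_nonneg (γ * e0 + L)]
      have h4 : e2 ^ 2 ≤ 3 * (L ^ 2 + (β * e1) ^ 2 + (γ * e0) ^ 2) / α ^ 2 := by
        rw [h2, div_pow]
        gcongr
      calc e0 ^ 2 + e1 ^ 2 + e2 ^ 2
          ≤ e0 ^ 2 + e1 ^ 2 + 3 * (L ^ 2 + (β * e1) ^ 2 + (γ * e0) ^ 2) / α ^ 2 := by gcongr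
        _ = _ := by ring
  have h5 := mul_le_mul_of_nonneg_left h0 (show 0 ≤ 1 + 3 * γ ^ 2 / α ^ 2 by positivity)
  have h6 := mul_le_mul_of_nonneg_left h1 (show 0 ≤ 1 + 3 * β ^ 2 / α ^ 2
    + (1 + 3 * γ ^ 2 / α ^ 2) * (4 * (b - a) ^ 2) by positivity)
  linarith

/-- Control of the residual of a trial function through its moments against the test space. -/
lemma meshIntegral_residual_sq_le (hk : 2 ≤ k) (hx : IsMesh a b N x) (hh : IsMeshSize N x h)
    (hdeg : ∀ i ∈ Finset.Icc 1 N, (E i).natDegree ≤ k) {ρ : ℕ → ℝ → ℝ}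
    (hρ : ∀ i, Continuous (ρ i))
    (hres : ∀ Q : ℕ → Polynomial ℝ, (∀ i ∈ Finset.Icc 1 N, (Q i).natDegree ≤ k - 2) →
      meshIntegral N x (fun i t => (-α * (E i).derivative.derivative.eval t
        + β * (E i).derivative.eval t + γ * (E i).eval t) * (Q i).eval t)
      = meshIntegral N x (fun i t => ρ i t * (Q i).eval t)) :
    meshIntegral N x (fun i t => (-α * (E i).derivative.derivative.eval t
        + β * (E i).derivative.eval t + γ * (E i).eval t) ^ 2) ≤
      4 * meshIntegral N x (fun i t => ρ i t ^ 2)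
        + 48 * h ^ 2 * (β ^ 2 + γ ^ 2) * meshIntegral N x (fun i t => (E i).eval t ^ 2
          + (E i).derivative.eval t ^ 2 + (E i).derivative.derivative.eval t ^ 2) := by
  set z₀ : ℕ → ℝ := fun i => β * (E i).derivative.eval (x (i - 1))
    + γ * (E i).eval (x (i - 1)) with hz₀
  set V : ℕ → Polynomial ℝ := fun i => Polynomial.C (-α) * (E i).derivative.derivative
    + Polynomial.C (z₀ i) with hV
  have hVeval : ∀ i t, (V i).eval t = -α * (E i).derivative.derivative.eval t + z₀ i := by
    intro i t
    simp [hV]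
  have hVdeg : ∀ i ∈ Finset.Icc 1 N, (V i).natDegree ≤ k - 2 := fun i hi => by
    have h0 := hdeg i hi
    have h1 := Polynomial.natDegree_derivative_le (E i)
    have h2 := Polynomial.natDegree_derivative_le (E i).derivative
    refine (Polynomial.natDegree_add_le _ _).trans (max_le ?_ (by simp))
    exact (Polynomial.natDegree_C_mul_le _ _).trans (by omega)
  have hortho : meshIntegral N x (fun i t => (-α * (E i).derivative.derivative.eval t
        + β * (E i).derivative.eval t + γ * (E i).eval t) * (V i).eval t
        + (-1) * (ρ i t * (V i).eval t)) = 0 := by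
    rw [meshIntegral_add (fun i => by fun_prop) (fun i => by fun_prop), meshIntegral_const_mul,
      hres V hVdeg]
    ring
  have hw := meshIntegral_sq_le_of_eq_zero_left hx hh
    (w := fun i t => β * (E i).derivative.eval t + γ * (E i).eval t - z₀ i)
    (w' := fun i t => β * (E i).derivative.derivative.eval t + γ * (E i).derivative.eval t)
    (fun i t => ((((E i).derivative.hasDerivAt t).const_mul β).add
      (((E i).hasDerivAt t).const_mul γ)).sub_const _)
    (fun i => by fun_prop) (fun i _ => by simp [hz₀])
  have hw' := meshIntegral_mono hx
    (F := fun i t => (β * (E i).derivative.derivative.eval t + γ * (E i).derivative.eval t) ^ 2)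
    (G := fun i t => 2 * (β ^ 2 + γ ^ 2) * ((E i).eval t ^ 2
          + (E i).derivative.eval t ^ 2 + (E i).derivative.derivative.eval t ^ 2))
    (fun i => by fun_prop) (fun i => by fun_prop) fun i t _ => by
      generalize (E i).derivative.derivative.eval t = e2
      generalize (E i).derivative.eval t = e1
      generalize (E i).eval t = e0
      have h1 : 0 ≤ 2 * (β ^ 2 + γ ^ 2) * e0 ^ 2 + 2 * (β * e1) ^ 2 + 2 * (γ * e2) ^ 2
          + (β * e2 - γ * e1) ^ 2 := by positivity
      nlinarith
  rw [meshIntegral_const_mul] at hw'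
  have key := meshIntegral_le_linear hx 4 4 6
    (F := fun i t => (-α * (E i).derivative.derivative.eval t
        + β * (E i).derivative.eval t + γ * (E i).eval t) ^ 2)
    (G₁ := fun i t => (-α * (E i).derivative.derivative.eval t
        + β * (E i).derivative.eval t + γ * (E i).eval t) * (V i).eval t
        + (-1) * (ρ i t * (V i).eval t))
    (G₂ := fun i t => ρ i t ^ 2)
    (G₃ := fun i t => (β * (E i).derivative.eval t + γ * (E i).eval t - z₀ i) ^ 2)
    (fun i => by fun_prop) (fun i => by fun_prop) (fun i => by fun_prop) (fun i => by fun_prop)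
    fun i t _ => by
      rw [hVeval]
      generalize (E i).derivative.derivative.eval t = e2
      generalize (E i).derivative.eval t = e1
      generalize (E i).eval t = e0
      generalize ρ i t = r
      obtain ⟨v, hv⟩ : ∃ v, v = -α * e2 + z₀ i := ⟨_, rfl⟩
      obtain ⟨w, hw⟩ : ∃ w, w = β * e1 + γ * e0 - z₀ i := ⟨_, rfl⟩
      rw [show -α * e2 + β * e1 + γ * e0 = v + w by rw [hv, hw]; ring, ← hv, ← hw]
      nlinarith [sq_nonneg (v - w), sq_nonneg (v + w - r), sq_nonneg (r + w)]
  rw [hortho] at key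
  have h4 := mul_le_mul_of_nonneg_left hw' (show 0 ≤ 4 * h ^ 2 by positivity)
  linarith

end Stability

/-- The lower-order part of the operator applied to the projection error. -/
lemma meshIntegral_lower_order_error {k : ℕ} (hk : 2 ≤ k) {N : ℕ} {x : ℕ → ℝ} {a b h : ℝ}
    (hx : IsMesh a b N x) (hh : IsMeshSize N x h) {u : ℝ → ℝ} (hu : ContDiff ℝ (k + 1) u)
    {p : ℕ → Polynomial ℝ}
    (hp : ∀ i ∈ Finset.Icc 1 N, IsElemProj k u (x (i - 1)) (x i) (p i)) {M : ℝ}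
    (hM : ∀ y ∈ Set.Icc a b, |iteratedDeriv (k + 1) u y| ≤ M) (β γ : ℝ) :
    meshIntegral N x (fun i t => (β * (deriv u t - (p i).derivative.eval t)
        + γ * (u t - (p i).eval t)) ^ 2)
      ≤ (8 * β ^ 2 + 32 * γ ^ 2 * h ^ 2) * (b - a) * (h ^ k * M) ^ 2 := by
  have hu2 : ContDiff ℝ 2 u := hu.of_le (by norm_cast; omega)
  have hd1 : ∀ t, HasDerivAt u (deriv u t) t := fun t =>
    (hu2.differentiable (by norm_num) t).hasDerivAt
  have hd2 : ∀ t, HasDerivAt (deriv u) (iteratedDeriv 2 u t) t := fun t => by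
    rw [iteratedDeriv_succ, iteratedDeriv_one]
    exact ((hu2.differentiable_deriv_two) t).hasDerivAt
  have hc0 : Continuous u := hu2.continuous
  have hc1 : Continuous (deriv u) := hu2.continuous_deriv (by norm_num)
  have hc2 : Continuous (iteratedDeriv 2 u) := hu2.continuous_iteratedDeriv 2 le_rfl
  have hB := meshIntegral_projection_error hk hx hh hu hp hM
  have h1 := meshIntegral_sq_le_of_eq_zero_left hx hh
    (w := fun i t => deriv u t - (p i).derivative.eval t)
    (w' := fun i t => iteratedDeriv 2 u t - (p i).derivative.derivative.eval t)
    (fun i t => (hd2 t).sub ((p i).derivative.hasDerivAt t)) (fun i => by fun_prop)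
    (fun i hi => sub_eq_zero.2 (hp i hi).2.2.2.1.symm)
  have h0 := meshIntegral_sq_le_of_eq_zero_left hx hh
    (w := fun i t => u t - (p i).eval t)
    (w' := fun i t => deriv u t - (p i).derivative.eval t)
    (fun i t => (hd1 t).sub ((p i).hasDerivAt t)) (fun i => by fun_prop)
    (fun i hi => sub_eq_zero.2 (hp i hi).2.1.symm)
  have key := meshIntegral_le_linear hx (2 * β ^ 2) (2 * γ ^ 2) 0
    (F := fun i t => (β * (deriv u t - (p i).derivative.eval t)
        + γ * (u t - (p i).eval t)) ^ 2)
    (G₁ := fun i t => (deriv u t - (p i).derivative.eval t) ^ 2)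
    (G₂ := fun i t => (u t - (p i).eval t) ^ 2) (G₃ := fun _ _ => 0)
    (fun i => by fun_prop) (fun i => by fun_prop) (fun i => by fun_prop) (fun i => by fun_prop)
    fun i t _ => by
      nlinarith [sq_nonneg (β * (deriv u t - (p i).derivative.eval t)
        - γ * (u t - (p i).eval t))]
  have h2 := mul_le_mul_of_nonneg_left hB
    (show 0 ≤ (2 * β ^ 2 + 2 * γ ^ 2 * (4 * h ^ 2)) * (4 * h ^ 2) by positivity)
  have h3 := mul_le_mul_of_nonneg_left h1
    (show 0 ≤ 2 * β ^ 2 + 2 * γ ^ 2 * (4 * h ^ 2) by positivity)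
  have h4 := mul_le_mul_of_nonneg_left h0 (show 0 ≤ 2 * γ ^ 2 by positivity)
  have hpow : h ^ k = h * h ^ (k - 1) := by
    rw [← pow_succ', Nat.sub_add_cancel (by omega)]
  calc _ ≤ (2 * β ^ 2 + 2 * γ ^ 2 * (4 * h ^ 2)) * (4 * h ^ 2)
        * ((M * h ^ (k - 1)) ^ 2 * (b - a)) := by linarith
    _ = _ := by rw [hpow]; ring

/-- The difference of a trial function and the truncated Jacobi projection is a trial function. -/
lemma IsVh0.sub_projection {k N : ℕ} {x : ℕ → ℝ} {a b : ℝ} {P : ℕ → Polynomial ℝ}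
    (hP : IsVh0 k N x P) (hx : IsMesh a b N x) {u : ℝ → ℝ} (hua : u a = 0) (hub : u b = 0)
    {p : ℕ → Polynomial ℝ}
    (hp : ∀ i ∈ Finset.Icc 1 N, IsElemProj k u (x (i - 1)) (x i) (p i)) :
    IsVh0 k N x (fun i => P i - p i) := by
  obtain ⟨hPdeg, hPglue, hPglue', hPl, hPr⟩ := hP
  have hmem : ∀ i ∈ Finset.Icc 1 (N - 1), i ∈ Finset.Icc 1 N ∧ i + 1 ∈ Finset.Icc 1 N :=
    fun i hi => by
      simp only [Finset.mem_Icc] at hi ⊢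
      omega
  refine ⟨fun i hi => (Polynomial.natDegree_sub_le _ _).trans (max_le (hPdeg i hi) (hp i hi).1),
    fun i hi => ?_, fun i hi => ?_, ?_, ?_⟩
  · have h1 := (hp i (hmem i hi).1).2.2.1
    have h2 := (hp (i + 1) (hmem i hi).2).2.1
    rw [Nat.add_sub_cancel] at h2
    rw [Polynomial.eval_sub, Polynomial.eval_sub, hPglue i hi, h1, h2]
  · have h1 := (hp i (hmem i hi).1).2.2.2.2.1
    have h2 := (hp (i + 1) (hmem i hi).2).2.2.2.1
    rw [Nat.add_sub_cancel] at h2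
    rw [Polynomial.derivative_sub, Polynomial.derivative_sub, Polynomial.eval_sub,
      Polynomial.eval_sub, hPglue' i hi, h1, h2]
  · have h1 := (hp 1 (Finset.mem_Icc.2 ⟨le_rfl, hx.1⟩)).2.1
    rw [Nat.sub_self] at h1
    rw [Polynomial.eval_sub, hPl, h1, hx.2.1, hua, sub_zero]
  · have h1 := (hp N (Finset.mem_Icc.2 ⟨hx.1, le_rfl⟩)).2.2.1
    rw [Polynomial.eval_sub, hPr, h1, hx.2.2.1, hub, sub_zero]

/-- The consistency error of the projection involves only the lower-order terms. -/
lemma IsPGSol.galerkin_orthogonality {k N : ℕ} {x : ℕ → ℝ} {α β γ : ℝ} {u : ℝ → ℝ}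
    {P : ℕ → Polynomial ℝ}
    (hP : IsPGSol k N x α β γ
      (fun t => -α * iteratedDeriv 2 u t + β * deriv u t + γ * u t) P)
    (hu : ContDiff ℝ 2 u) {p : ℕ → Polynomial ℝ}
    (hp : ∀ i ∈ Finset.Icc 1 N, IsElemProj k u (x (i - 1)) (x i) (p i))
    (Q : ℕ → Polynomial ℝ) (hQ : ∀ i ∈ Finset.Icc 1 N, (Q i).natDegree ≤ k - 2) :
    meshIntegral N x (fun i t => (-α * (P i - p i).derivative.derivative.eval t
        + β * (P i - p i).derivative.eval t + γ * (P i - p i).eval t) * (Q i).eval t)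
      = meshIntegral N x (fun i t => (β * (deriv u t - (p i).derivative.eval t)
        + γ * (u t - (p i).eval t)) * (Q i).eval t) := by
  have hc0 : Continuous u := hu.continuous
  have hc1 : Continuous (deriv u) := hu.continuous_deriv (by norm_num)
  have hc2 : Continuous (iteratedDeriv 2 u) := hu.continuous_iteratedDeriv 2 le_rfl
  have h1 : meshIntegral N x (fun i t => (-α * (P i).derivative.derivative.eval t
      + β * (P i).derivative.eval t + γ * (P i).eval t) * (Q i).eval t)
    = meshIntegral N x (fun i t => (-α * iteratedDeriv 2 u t + β * deriv u t + γ * u t)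
      * (Q i).eval t) := hP.2 Q hQ
  have h2 : meshIntegral N x (fun i t =>
      (iteratedDeriv 2 u t - (p i).derivative.derivative.eval t) * (Q i).eval t) = 0 :=
    Finset.sum_eq_zero fun i hi => (hp i hi).2.2.2.2.2 (Q i) (hQ i hi)
  have h3 : meshIntegral N x (fun i t => (-α * (P i - p i).derivative.derivative.eval t
        + β * (P i - p i).derivative.eval t + γ * (P i - p i).eval t) * (Q i).eval t
        + (-α * iteratedDeriv 2 u t + β * deriv u t + γ * u t) * (Q i).eval t)
      = meshIntegral N x (fun i t => ((-α * (P i).derivative.derivative.eval t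
        + β * (P i).derivative.eval t + γ * (P i).eval t) * (Q i).eval t
        + (β * (deriv u t - (p i).derivative.eval t)
          + γ * (u t - (p i).eval t)) * (Q i).eval t)
        + (-α) * ((iteratedDeriv 2 u t - (p i).derivative.derivative.eval t)
          * (Q i).eval t)) :=
    meshIntegral_congr fun i t => by
      simp only [Polynomial.derivative_sub, Polynomial.eval_sub]
      ring
  rw [meshIntegral_add (fun i => by fun_prop) (fun i => by fun_prop),
    meshIntegral_add (fun i => by fun_prop) (fun i => by fun_prop),
    meshIntegral_add (fun i => by fun_prop) (fun i => by fun_prop),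
    meshIntegral_const_mul, h1, h2] at h3
  linarith

/-- Absorption of the lower-order terms of the residual on a fine mesh. -/
lemma le_of_stability_of_residual {K S G R B h s : ℝ} (hK : 0 ≤ K) (hS : 0 ≤ S) (hh : 0 ≤ h)
    (hs : 0 ≤ s) (hsmall : h * (1 + 96 * s * K) ≤ 1) (hSG : S ≤ K * G)
    (hG : G ≤ 4 * R + 48 * h ^ 2 * s * S) (hR : R ≤ B) : S ≤ 8 * K * B := by
  have hsK : 0 ≤ 96 * s * K := by positivity
  have hle : h ≤ 1 := by nlinarith
  have h1 : h ^ 2 * (96 * s * K) ≤ 1 := by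
    calc h ^ 2 * (96 * s * K) ≤ h * (96 * s * K) := by gcongr; nlinarith
      _ ≤ 1 := by linarith
  have h2 := mul_le_mul_of_nonneg_left hG hK
  have h3 := mul_le_mul_of_nonneg_right h1 hS
  have h4 := mul_le_mul_of_nonneg_left hR hK
  linarith

/-- Supercloseness between the Petrov–Galerkin solution and the truncated Jacobi projection
in the `H²` norm: `‖u_h - u_I‖_2 ≤ C h^k |u|_{k+1,∞}`, and if moreover `β = 0` and `γ ≠ 0`
then `‖u_h - u_I‖_2 ≤ C h^{k+1} |u|_{k+1,∞}`. -/
theorem petrov_galerkin_supercloseness_H2 (k : ℕ) (hk : 3 ≤ k)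
    (α β γ c d : ℝ) (hα : 0 < α) (hγ : 0 ≤ γ) (hc : 1 ≤ c) (hd : 0 < d) :
    ∃ C > 0, ∃ h₀ > 0, ∀ (a b : ℝ), b - a = d →
      ∀ (N : ℕ) (x : ℕ → ℝ) (h : ℝ),
        IsMesh a b N x → IsMeshSize N x h → IsQuasiUniform N x h c → h ≤ h₀ →
      ∀ u : ℝ → ℝ, ContDiff ℝ (k + 1) u → u a = 0 → u b = 0 →
      ∀ P : ℕ → Polynomial ℝ,
        IsPGSol k N x α β γ (fun t => -α * iteratedDeriv 2 u t + β * deriv u t + γ * u t) P →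
      ∀ p : ℕ → Polynomial ℝ, (∀ i ∈ Finset.Icc 1 N, IsElemProj k u (x (i - 1)) (x i) (p i)) →
      ∀ M : ℝ, (∀ y ∈ Set.Ioo a b, |iteratedDeriv (k + 1) u y| ≤ M) →
        Real.sqrt (∑ i ∈ Finset.Icc 1 N, ∫ t in (x (i - 1))..(x i),
              (((P i - p i).eval t) ^ 2
                + ((Polynomial.derivative (P i - p i)).eval t) ^ 2
                + ((Polynomial.derivative (Polynomial.derivative (P i - p i))).eval t) ^ 2))
          ≤ C * h ^ k * M ∧
        (β = 0 → γ ≠ 0 →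
          Real.sqrt (∑ i ∈ Finset.Icc 1 N, ∫ t in (x (i - 1))..(x i),
                (((P i - p i).eval t) ^ 2
                  + ((Polynomial.derivative (P i - p i)).eval t) ^ 2
                  + ((Polynomial.derivative (Polynomial.derivative (P i - p i))).eval t) ^ 2))
            ≤ C * h ^ (k + 1) * M) := by
  obtain ⟨K, hK⟩ : ∃ K, K = 3 / α ^ 2 + (1 + 3 * β ^ 2 / α ^ 2
    + (1 + 3 * γ ^ 2 / α ^ 2) * (4 * d ^ 2)) * (4 * d ^ 2 / α ^ 2) := ⟨_, rfl⟩
  have hK0 : 0 < K := by rw [hK]; positivity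
  obtain ⟨D, hD⟩ : ∃ D, D = 1 + 96 * (β ^ 2 + γ ^ 2) * K := ⟨_, rfl⟩
  have hD1 : 1 ≤ D := by rw [hD]; exact le_add_of_nonneg_right (by positivity)
  have hD0 : 0 < D := one_pos.trans_le hD1
  obtain ⟨C, hC⟩ : ∃ C, C = 1 + 8 * K * (8 * β ^ 2 + 32 * γ ^ 2) * d := ⟨_, rfl⟩
  have hC1 : 1 ≤ C := by rw [hC]; exact le_add_of_nonneg_right (by positivity)
  have hCsq : 8 * K * (8 * β ^ 2 + 32 * γ ^ 2) * d ≤ C ^ 2 := by nlinarith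
  refine ⟨C, by linarith, 1 / D, by positivity, ?_⟩
  intro a b hab N x h hx hh _ hle u hu hua hub P hP p hp M hM
  have hlt : a < b := by linarith
  obtain ⟨j, hj, hjh⟩ := hh.2
  have hpos : 0 < h := by linarith [hx.prev_lt hj]
  have hle1 : h ≤ 1 := hle.trans (div_le_one_of_le₀ hD1 hD0.le)
  have hM' : ∀ y ∈ Set.Icc a b, |iteratedDeriv (k + 1) u y| ≤ M := by
    have hcont : Continuous fun y => |iteratedDeriv (k + 1) u y| :=
      (hu.continuous_iteratedDeriv (k + 1) (by norm_cast)).abs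
    have hsub := closure_minimal (s := Set.Ioo a b) hM (isClosed_le hcont continuous_const)
    rwa [closure_Ioo hlt.ne] at hsub
  have hM0 : 0 ≤ M := (abs_nonneg _).trans (hM' a ⟨le_rfl, hlt.le⟩)
  have hu2 : ContDiff ℝ 2 u := hu.of_le (by norm_cast; omega)
  have hc0 : Continuous u := hu2.continuous
  have hc1 : Continuous (deriv u) := hu2.continuous_deriv (by norm_num)
  have hE : IsVh0 k N x (fun i => P i - p i) := hP.1.sub_projection hx hua hub hp
  have hres := hP.galerkin_orthogonality hu2 hp
  have hR := meshIntegral_lower_order_error (by omega) hx hh hu hp hM' β γ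
  have hG := meshIntegral_residual_sq_le (by omega) hx hh hE.1
    (fun i => by fun_prop) hres
  have hS := hE.meshIntegral_H2_le (β := β) hα hγ hlt hx
  rw [hab] at hR hS
  rw [← hK] at hS
  have hS0 : 0 ≤ meshIntegral N x (fun i t => (P i - p i).eval t ^ 2
      + (P i - p i).derivative.eval t ^ 2 + (P i - p i).derivative.derivative.eval t ^ 2) :=
    meshIntegral_nonneg hx fun i t => by positivity
  have hbound : meshIntegral N x (fun i t => (P i - p i).eval t ^ 2
      + (P i - p i).derivative.eval t ^ 2 + (P i - p i).derivative.derivative.eval t ^ 2)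
      ≤ 8 * K * ((8 * β ^ 2 + 32 * γ ^ 2 * h ^ 2) * d * (h ^ k * M) ^ 2) :=
    le_of_stability_of_residual hK0.le hS0 hpos.le (by positivity)
      (hD ▸ (le_div_iff₀ hD0).1 hle) hS hG hR
  change Real.sqrt (meshIntegral N x (fun i t => (P i - p i).eval t ^ 2
      + (P i - p i).derivative.eval t ^ 2 + (P i - p i).derivative.derivative.eval t ^ 2)) ≤ _ ∧
    (_ → _ → Real.sqrt (meshIntegral N x (fun i t => (P i - p i).eval t ^ 2
      + (P i - p i).derivative.eval t ^ 2 + (P i - p i).derivative.derivative.eval t ^ 2)) ≤ _)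
  generalize meshIntegral N x (fun i t => (P i - p i).eval t ^ 2
      + (P i - p i).derivative.eval t ^ 2 + (P i - p i).derivative.derivative.eval t ^ 2) = S at hbound ⊢
  clear hG hS hS0 hR
  have hh1 : h ^ 2 ≤ 1 := by nlinarith
  refine ⟨Real.sqrt_le_iff.2 ⟨by positivity, ?_⟩, fun hβ _ =>
    Real.sqrt_le_iff.2 ⟨by positivity, ?_⟩⟩
  · calc S ≤ 8 * K * ((8 * β ^ 2 + 32 * γ ^ 2 * h ^ 2) * d * (h ^ k * M) ^ 2) := hbound
      _ ≤ 8 * K * ((8 * β ^ 2 + 32 * γ ^ 2 * 1) * d * (h ^ k * M) ^ 2) := by gcongr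
      _ ≤ C ^ 2 * (h ^ k * M) ^ 2 := by
          rw [mul_one, ← mul_assoc, ← mul_assoc]
          exact mul_le_mul_of_nonneg_right hCsq (sq_nonneg _)
      _ = (C * h ^ k * M) ^ 2 := by ring
  · calc S ≤ 8 * K * ((8 * β ^ 2 + 32 * γ ^ 2 * h ^ 2) * d * (h ^ k * M) ^ 2) := hbound
      _ = 8 * K * (8 * β ^ 2 + 32 * γ ^ 2) * d * (h ^ (k + 1) * M) ^ 2 := by rw [hβ]; ring
      _ ≤ C ^ 2 * (h ^ (k + 1) * M) ^ 2 := mul_le_mul_of_nonneg_right hCsq (sq_nonneg _)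
      _ = (C * h ^ (k + 1) * M) ^ 2 := by ring
end

section
/- Suppose β=0 and γ=0 (so the equation is -αu''=f with α>0). If u is (k+1)-times continuously differentiable with u(a)=u(b)=0, f := -αu'', and u_h is a Petrov–Galerkin solution, then u_h coincides with the truncated Jacobi projection u_I of u; in particular (u-u_h)(x_i)=0 and (u-u_h)'(x_i)=0 at every mesh node x_i, i=0,...,N. -/
open Set Finset intervalIntegral

/-- A polynomial whose square integrates to zero over a nondegenerate interval vanishes. -/
lemma Polynomial.eq_zero_of_integral_mul_self_eq_zero {r : Polynomial ℝ} {c d : ℝ} (hcd : c < d)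
    (h : ∫ t in c..d, r.eval t * r.eval t = 0) : r = 0 := by
  refine r.eq_zero_of_infinite_isRoot ((Set.Icc_infinite hcd).mono fun s hs => ?_)
  by_contra hne
  have hpos : 0 < ∫ t in c..d, r.eval t * r.eval t :=
    intervalIntegral.integral_pos hcd (by fun_prop) (fun t _ => mul_self_nonneg _)
      ⟨s, hs, mul_self_pos.2 hne⟩
  exact hpos.ne' h

/-- A polynomial with vanishing second derivative is its first-order Taylor polynomial. -/
lemma Polynomial.eq_affine_of_derivative_derivative_eq_zero {E : Polynomial ℝ}
    (h : Polynomial.derivative (Polynomial.derivative E) = 0) (z : ℝ) :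
    E = Polynomial.C (E.eval z)
      + Polynomial.C ((Polynomial.derivative E).eval z) * (Polynomial.X - Polynomial.C z) := by
  have hE' := Polynomial.eq_C_of_derivative_eq_zero h
  set m := (Polynomial.derivative E).coeff 0
  have hm : (Polynomial.derivative E).eval z = m := by rw [hE', Polynomial.eval_C]
  have hF : Polynomial.derivative (E - Polynomial.C m * Polynomial.X) = 0 := by
    simp [hE']
  have hc := Polynomial.eq_C_of_derivative_eq_zero hF
  set c := (E - Polynomial.C m * Polynomial.X).coeff 0
  have hE : E = Polynomial.C c + Polynomial.C m * Polynomial.X := by rw [← hc]; ring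
  have hz : E.eval z = c + m * z := by rw [hE]; simp
  rw [hm, hz]
  nth_rewrite 1 [hE]
  simp only [map_add, map_mul]
  ring

/-- A Petrov–Galerkin solution satisfies the variational equation on every single element. -/
lemma IsPGSol.integral_eq {k N : ℕ} {x : ℕ → ℝ} {α β γ : ℝ} {f : ℝ → ℝ} {P : ℕ → Polynomial ℝ}
    (hP : IsPGSol k N x α β γ f P) {i : ℕ} (hi : i ∈ Finset.Icc 1 N) {q : Polynomial ℝ}
    (hq : q.natDegree ≤ k - 2) :
    ∫ t in (x (i - 1))..(x i),
        (-α * ((Polynomial.derivative (Polynomial.derivative (P i))).eval t)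
            + β * ((Polynomial.derivative (P i)).eval t) + γ * (P i).eval t) * q.eval t
      = ∫ t in (x (i - 1))..(x i), f t * q.eval t := by
  have h := hP.2 (Pi.single i q) fun j _ => by
    rcases eq_or_ne j i with rfl | hj
    · simpa using hq
    · simp [Pi.single_eq_of_ne hj]
  rw [Finset.sum_eq_single_of_mem i hi fun j _ hj => by simp [Pi.single_eq_of_ne hj],
    Finset.sum_eq_single_of_mem i hi fun j _ hj => by simp [Pi.single_eq_of_ne hj]] at h
  simpa only [Pi.single_eq_same] using h

/-- The elements of a mesh are nondegenerate. -/
lemma IsMesh.left_lt {a b : ℝ} {N : ℕ} {x : ℕ → ℝ} (h : IsMesh a b N x) {i : ℕ}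
    (hi : i ∈ Finset.Icc 1 N) : x (i - 1) < x i := by
  obtain ⟨h1, h2⟩ := Finset.mem_Icc.1 hi
  have := h.2.2.2 (i - 1) (by omega)
  rwa [Nat.sub_add_cancel h1] at this

/-- For `-α u'' = f`, the Petrov–Galerkin solution and the elementwise projection have the same
second derivative on every element. -/
lemma IsPGSol.derivative_derivative_sub_eq_zero {k N : ℕ} {x : ℕ → ℝ} {α : ℝ} (hα : α ≠ 0)
    {u : ℝ → ℝ} (hu : Continuous (iteratedDeriv 2 u)) {P : ℕ → Polynomial ℝ}
    (hP : IsPGSol k N x α 0 0 (fun t => -α * iteratedDeriv 2 u t) P) {i : ℕ}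
    (hi : i ∈ Finset.Icc 1 N) (hx : x (i - 1) < x i) {p : Polynomial ℝ}
    (hp : IsElemProj k u (x (i - 1)) (x i) p) :
    Polynomial.derivative (Polynomial.derivative (P i - p)) = 0 := by
  set r := Polynomial.derivative (Polynomial.derivative (P i - p)) with hr
  have hdeg : r.natDegree ≤ k - 2 := by
    have h0 : (P i - p).natDegree ≤ k :=
      (Polynomial.natDegree_sub_le _ _).trans (max_le (hP.1.1 i hi) hp.1)
    have h1 := Polynomial.natDegree_derivative_le (P i - p)
    have h2 := Polynomial.natDegree_derivative_le (Polynomial.derivative (P i - p))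
    rw [← hr] at h2
    omega
  have hG := hP.integral_eq hi hdeg
  have hJ := hp.2.2.2.2.2 r hdeg
  refine Polynomial.eq_zero_of_integral_mul_self_eq_zero hx ?_
  have hG' : ∫ t in (x (i - 1))..(x i), -α *
      (((Polynomial.derivative (Polynomial.derivative (P i))).eval t - iteratedDeriv 2 u t)
        * r.eval t) = 0 := by
    rw [← sub_eq_zero, ← intervalIntegral.integral_sub
      (Continuous.intervalIntegrable (by fun_prop) _ _)
      (Continuous.intervalIntegrable (by fun_prop) _ _)] at hG
    rw [← hG]
    congr 1 with t
    ring
  rw [intervalIntegral.integral_const_mul, mul_eq_zero] at hG'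
  have hG'' := hG'.resolve_left (neg_ne_zero.2 hα)
  rw [← add_zero (0 : ℝ)]
  nth_rewrite 1 [← hG'']
  rw [← hJ, ← intervalIntegral.integral_add
      (Continuous.intervalIntegrable (by fun_prop) _ _)
      (Continuous.intervalIntegrable (by fun_prop) _ _)]
  congr 1 with t
  have : r.eval t = (Polynomial.derivative (Polynomial.derivative (P i))).eval t
      - (Polynomial.derivative (Polynomial.derivative p)).eval t := by
    simp [hr]
  linear_combination r.eval t * this

/-- When `β = γ = 0` (the equation is `-α u'' = f`), the Petrov–Galerkin solution coincides
with the truncated Jacobi projection `u_I` of `u`; in particular `(u - u_h)(x_i) = 0` and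
`(u - u_h)'(x_i) = 0` at every mesh node. -/
theorem petrov_galerkin_equals_projection_of_beta_gamma_zero
    (a b : ℝ) (hab : a < b) (k : ℕ) (hk : 3 ≤ k)
    (N : ℕ) (x : ℕ → ℝ) (hmesh : IsMesh a b N x)
    (α : ℝ) (hα : 0 < α)
    (u : ℝ → ℝ) (hu : ContDiff ℝ (k + 1) u) (hua : u a = 0) (hub : u b = 0)
    (P : ℕ → Polynomial ℝ)
    (hP : IsPGSol k N x α 0 0 (fun t => -α * iteratedDeriv 2 u t) P)
    (p : ℕ → Polynomial ℝ)
    (hp : ∀ i ∈ Finset.Icc 1 N, IsElemProj k u (x (i - 1)) (x i) (p i)) :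
    (∀ i ∈ Finset.Icc 1 N, P i = p i) ∧
    (u (x 0) - (P 1).eval (x 0) = 0) ∧
    (deriv u (x 0) - (Polynomial.derivative (P 1)).eval (x 0) = 0) ∧
    ∀ i ∈ Finset.Icc 1 N,
      u (x i) - (P i).eval (x i) = 0 ∧
      deriv u (x i) - (Polynomial.derivative (P i)).eval (x i) = 0 := by
  have hu2 : Continuous (iteratedDeriv 2 u) :=
    hu.continuous_iteratedDeriv 2 (by norm_cast; omega)
  have hE2 : ∀ i ∈ Finset.Icc 1 N,
      Polynomial.derivative (Polynomial.derivative (P i - p i)) = 0 := fun i hi =>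
    hP.derivative_derivative_sub_eq_zero hα.ne' hu2 hi (hmesh.left_lt hi) (hp i hi)
  obtain ⟨-, hPv, hPd, hP0, hPN⟩ := hP.1
  have hN := hmesh.1
  have hconst : ∀ n, 1 ≤ n → n ≤ N → P n - p n = P 1 - p 1 := by
    intro n hn
    induction n, hn using Nat.le_induction with
    | base => exact fun _ => rfl
    | succ n hn ih =>
      intro hnN
      have hmem : n ∈ Finset.Icc 1 N := Finset.mem_Icc.2 ⟨hn, by omega⟩
      have hmem' : n + 1 ∈ Finset.Icc 1 N := Finset.mem_Icc.2 ⟨by omega, hnN⟩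
      have hint : n ∈ Finset.Icc 1 (N - 1) := Finset.mem_Icc.2 ⟨hn, by omega⟩
      obtain ⟨-, -, hv, -, hd, -⟩ := hp n hmem
      obtain ⟨-, hv', -, hd', -, -⟩ := hp (n + 1) hmem'
      rw [Nat.add_sub_cancel] at hv' hd'
      rw [← ih (by omega),
        Polynomial.eq_affine_of_derivative_derivative_eq_zero (hE2 n hmem) (x n),
        Polynomial.eq_affine_of_derivative_derivative_eq_zero (hE2 (n + 1) hmem') (x n)]
      simp only [Polynomial.derivative_sub, Polynomial.eval_sub, hv, hd, hv', hd',
        hPv n hint, hPd n hint]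
  have h1 : 1 ∈ Finset.Icc 1 N := Finset.mem_Icc.2 ⟨le_rfl, hN⟩
  have hNm : N ∈ Finset.Icc 1 N := Finset.mem_Icc.2 ⟨hN, le_rfl⟩
  have hleft : (P 1 - p 1).eval a = 0 := by
    have h := (hp 1 h1).2.1
    rw [Nat.sub_self, hmesh.2.1] at h
    rw [hmesh.2.1] at hP0
    rw [Polynomial.eval_sub, hP0, h, hua, sub_zero]
  have hright : (P 1 - p 1).eval b = 0 := by
    have h := (hp N hNm).2.2.1
    rw [hmesh.2.2.1] at h hPN
    rw [← hconst N hN le_rfl, Polynomial.eval_sub, hPN, h, hub, sub_zero]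
  have hzero : P 1 - p 1 = 0 := by
    have haff := Polynomial.eq_affine_of_derivative_derivative_eq_zero (hE2 1 h1) a
    rw [hleft, Polynomial.C_0, zero_add] at haff
    have hm : (Polynomial.derivative (P 1 - p 1)).eval a * (b - a) = 0 := by
      rw [haff] at hright
      simpa only [Polynomial.eval_mul, Polynomial.eval_sub, Polynomial.eval_C,
        Polynomial.eval_X] using hright
    rw [haff, (mul_eq_zero.1 hm).resolve_right (sub_ne_zero.2 hab.ne'), Polynomial.C_0, zero_mul]
  have heq : ∀ i ∈ Finset.Icc 1 N, P i = p i := fun i hi => by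
    obtain ⟨hi1, hiN⟩ := Finset.mem_Icc.1 hi
    exact sub_eq_zero.1 ((hconst i hi1 hiN).trans hzero)
  refine ⟨heq, ?_, ?_, fun i hi => ⟨?_, ?_⟩⟩
  · rw [heq 1 h1]; exact sub_eq_zero.2 (hp 1 h1).2.1.symm
  · rw [heq 1 h1]; exact sub_eq_zero.2 (hp 1 h1).2.2.2.1.symm
  · rw [heq i hi]; exact sub_eq_zero.2 (hp i hi).2.2.1.symm
  · rw [heq i hi]; exact sub_eq_zero.2 (hp i hi).2.2.2.2.1.symm
end

section
/- Let k ≥ 4. There exist constants C>0 and h_0>0, depending only on k, α, β, γ, b-a and the quasi-uniformity constant c, such that whenever h ≤ h_0, u is (k+2)-times continuously differentiable with u(a)=u(b)=0, f := -αu''+βu'+γu, and u_h is a Petrov–Galerkin solution, then |(u-u_h)(l_{im})| ≤ C h^{k+2} ‖u‖_{k+2,∞} at each of the k-3 interior Jacobi points l_{im} of every element τ_i. -/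
open Set Finset intervalIntegral

lemma abs_sub_taylor_sum_le {f : ℝ → ℝ} {n : ℕ} (hf : ContDiff ℝ (n + 1) f) {p q K : ℝ}
    (hK : ∀ y ∈ Set.Ioo p q, |iteratedDeriv (n + 1) f y| ≤ K) {t : ℝ} (ht : t ∈ Set.Icc p q) :
    |f t - ∑ i ∈ Finset.range (n + 1), iteratedDeriv i f p / i.factorial * (t - p) ^ i|
      ≤ K * (t - p) ^ (n + 1) := by
  rcases eq_or_lt_of_le ht.1 with rfl | hpt
  · rw [Finset.sum_range_succ']
    simp
  · obtain ⟨y, hy, h⟩ := taylor_mean_remainder_lagrange_iteratedDeriv (n := n) hpt.ne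
      (hf.contDiffOn)
    rw [uIoo_of_lt hpt] at hy
    have hsum : taylorWithinEval f n (Set.uIcc p t) p t
        = ∑ i ∈ Finset.range (n + 1), iteratedDeriv i f p / i.factorial * (t - p) ^ i := by
      rw [taylor_within_apply]
      refine Finset.sum_congr rfl fun i hi => ?_
      rw [iteratedDerivWithin_eq_iteratedDeriv (s := Set.uIcc p t)
        (uniqueDiffOn_Icc (by simpa using hpt.ne')) ((hf.of_le ?_).contDiffAt) Set.left_mem_uIcc]
      · simp only [smul_eq_mul]
        ring
      · have : i ≤ n + 1 := (Finset.mem_range.1 hi).le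
        exact_mod_cast this
    rw [← hsum, h]
    have h1 : (1 : ℝ) ≤ (n + 1).factorial := by exact_mod_cast Nat.one_le_iff_ne_zero.2 (Nat.factorial_ne_zero _)
    have hy' := hK y ⟨hy.1, hy.2.trans_le ht.2⟩
    have h0 : 0 ≤ (t - p) ^ (n + 1) := pow_nonneg (by linarith) _
    rw [abs_div, abs_mul, abs_of_nonneg h0, Nat.abs_cast]
    exact (div_le_self (by positivity) h1).trans (by gcongr)

lemma exists_polynomial_approx {f : ℝ → ℝ} {n : ℕ} (hf : ContDiff ℝ (n + 1) f) {p q K h : ℝ}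
    (hqh : q - p ≤ h) (hK0 : 0 ≤ K)
    (hK : ∀ y ∈ Set.Ioo p q, |iteratedDeriv (n + 1) f y| ≤ K) :
    ∃ Q : Polynomial ℝ, Q.natDegree ≤ n ∧
      ∀ t ∈ Set.Icc p q, |f t - Q.eval t| ≤ K * h ^ (n + 1) := by
  refine ⟨∑ i ∈ Finset.range (n + 1), Polynomial.C (iteratedDeriv i f p / i.factorial) *
    (Polynomial.X - Polynomial.C p) ^ i, ?_, fun t ht => ?_⟩
  · refine Polynomial.natDegree_sum_le_of_forall_le _ _ fun i hi => ?_
    refine (Polynomial.natDegree_C_mul_le _ _).trans ?_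
    rw [Polynomial.natDegree_pow, Polynomial.natDegree_X_sub_C]
    have := Finset.mem_range.1 hi
    omega
  · have := abs_sub_taylor_sum_le hf hK ht
    simp only [Polynomial.eval_finsetSum, Polynomial.eval_mul, Polynomial.eval_C,
      Polynomial.eval_pow, Polynomial.eval_sub, Polynomial.eval_X]
    refine this.trans ?_
    have h1 : t - p ≤ h := by linarith [ht.2]
    have h2 : 0 ≤ t - p := by linarith [ht.1]
    gcongr

/-- If `g` is `L²`-orthogonal to a polynomial `Q` that approximates it up to `B`, then
`g` is bounded by `B` in the scaled `L¹` norm. -/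
lemma integral_abs_le_of_orthogonal {g : ℝ → ℝ} (hg : Continuous g) {p q B : ℝ} (hpq : p ≤ q)
    (hB : 0 ≤ B) {Q : Polynomial ℝ} (horth : ∫ t in p..q, g t * Q.eval t = 0)
    (happ : ∀ t ∈ Set.Icc p q, |g t - Q.eval t| ≤ B) :
    ∫ t in p..q, |g t| ≤ (q - p) * B := by
  have hQ : Continuous fun t => Q.eval t := Q.continuous
  have hi1 : IntervalIntegrable (fun t => g t ^ 2) MeasureTheory.volume p q :=
    (hg.pow 2).intervalIntegrable _ _
  have hi2 : IntervalIntegrable (fun t => 2 * (g t * Q.eval t)) MeasureTheory.volume p q :=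
    ((hg.mul hQ).const_mul _ |>.intervalIntegrable _ _)
  have hsq : ∀ B' : ℝ, B ≤ B' → ∫ t in p..q, g t ^ 2 ≤ (q - p) * B' ^ 2 := by
    intro B' hB'
    have h1 : ∫ t in p..q, g t ^ 2 = ∫ t in p..q, (g t ^ 2 - 2 * (g t * Q.eval t)) := by
      rw [intervalIntegral.integral_sub hi1 hi2, intervalIntegral.integral_const_mul, horth]
      ring
    have h2 : ∫ t in p..q, (g t ^ 2 - 2 * (g t * Q.eval t)) ≤ ∫ t in p..q, B' ^ 2 := by
      refine intervalIntegral.integral_mono_on hpq (hi1.sub hi2)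
        (continuous_const.intervalIntegrable _ _) fun t ht => ?_
      have := abs_le.1 ((happ t ht).trans hB')
      nlinarith [sq_nonneg (Q.eval t)]
    rw [h1]
    simpa [mul_comm] using h2
  refine le_of_forall_pos_le_add fun ε hε => ?_
  have hd : 0 < q - p + 1 := by linarith
  set δ := ε / (q - p + 1) with hδ
  have hδ0 : 0 < δ := by positivity
  have hB' : 0 < B + δ := by linarith
  have h3 : ∫ t in p..q, |g t| ≤ ∫ t in p..q, ((B + δ)⁻¹ / 2 * g t ^ 2 + (B + δ) / 2) := by
    refine intervalIntegral.integral_mono_on hpq (hg.abs.intervalIntegrable _ _)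
      (((hg.pow 2).const_mul _).add continuous_const |>.intervalIntegrable _ _) fun t ht => ?_
    have : 0 ≤ (B + δ)⁻¹ / 2 * (|g t| - (B + δ)) ^ 2 := by positivity
    have h4 : (B + δ)⁻¹ / 2 * (|g t| - (B + δ)) ^ 2
        = (B + δ)⁻¹ / 2 * |g t| ^ 2 + (B + δ) / 2 - |g t| := by
      field_simp
      ring
    rw [h4, sq_abs] at this
    linarith
  have h5 : ∫ t in p..q, ((B + δ)⁻¹ / 2 * g t ^ 2 + (B + δ) / 2)
      = (B + δ)⁻¹ / 2 * (∫ t in p..q, g t ^ 2) + (q - p) * ((B + δ) / 2) := by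
    rw [intervalIntegral.integral_add (hi1.const_mul _) (continuous_const.intervalIntegrable _ _),
      intervalIntegral.integral_const_mul, intervalIntegral.integral_const, smul_eq_mul]
  have h6 : (B + δ)⁻¹ / 2 * (∫ t in p..q, g t ^ 2) ≤ (B + δ)⁻¹ / 2 * ((q - p) * (B + δ) ^ 2) := by
    gcongr
    exact hsq _ (by linarith)
  have h7 : (B + δ)⁻¹ / 2 * ((q - p) * (B + δ) ^ 2) = (q - p) * ((B + δ) / 2) := by
    field_simp
  have h8 : (q - p) * δ ≤ ε := by
    rw [hδ, mul_div_assoc', div_le_iff₀ hd]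
    nlinarith
  nlinarith

lemma abs_integral_mul_le_of_integral_abs_le {g w : ℝ → ℝ} (hg : Continuous g) (hw : Continuous w)
    {p q B ε : ℝ} (hpq : p ≤ q) (hε : 0 ≤ ε) (hgB : ∫ t in p..q, |g t| ≤ B)
    (hwε : ∀ t ∈ Set.Icc p q, |w t| ≤ ε) :
    |∫ t in p..q, w t * g t| ≤ ε * B := by
  refine (intervalIntegral.abs_integral_le_integral_abs hpq).trans ?_
  have : ∫ t in p..q, |w t * g t| ≤ ∫ t in p..q, ε * |g t| := by
    refine intervalIntegral.integral_mono_on hpq ((hw.mul hg).abs.intervalIntegrable _ _)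
      ((hg.abs.const_mul _).intervalIntegrable _ _) fun t ht => ?_
    rw [abs_mul]
    exact mul_le_mul_of_nonneg_right (hwε t ht) (abs_nonneg _)
  rw [intervalIntegral.integral_const_mul] at this
  exact this.trans (by gcongr)

lemma abs_integral_mul_le_of_orthogonal {g w : ℝ → ℝ} (hg : Continuous g) (hw : Continuous w)
    {p q B ε : ℝ} (hpq : p ≤ q) (hε : 0 ≤ ε) (hgB : ∫ t in p..q, |g t| ≤ B) {Q : Polynomial ℝ}
    (horth : ∫ t in p..q, g t * Q.eval t = 0)
    (hwε : ∀ t ∈ Set.Icc p q, |w t - Q.eval t| ≤ ε) :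
    |∫ t in p..q, w t * g t| ≤ ε * B := by
  have hQ : Continuous fun t => Q.eval t := Q.continuous
  have h := abs_integral_mul_le_of_integral_abs_le hg (hw.sub hQ) hpq hε hgB hwε
  have h1 : ∫ t in p..q, (w t - Q.eval t) * g t
      = (∫ t in p..q, w t * g t) - ∫ t in p..q, g t * Q.eval t := by
    rw [← intervalIntegral.integral_sub (Continuous.intervalIntegrable (by fun_prop) _ _)
      (Continuous.intervalIntegrable (by fun_prop) _ _)]
    exact intervalIntegral.integral_congr fun t _ => by ring
  simp only [Pi.sub_apply] at h
  rwa [h1, horth, sub_zero] at h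
open Polynomial in
/-- The polynomial `((X - p) (X - q)) ^ n` whose `n`-th derivative is the Legendre polynomial
of `[p, q]` up to scaling. -/
noncomputable def rodriguesBase (p q : ℝ) (n : ℕ) : ℝ[X] := ((X - C p) * (X - C q)) ^ n

section Rodrigues

open Polynomial

lemma eval_iterate_derivative_rodriguesBase {p q : ℝ} {n j : ℕ} (hj : j < n) {t : ℝ}
    (ht : t = p ∨ t = q) : (derivative^[j] (rodriguesBase p q n)).eval t = 0 := by
  obtain ⟨r, hr⟩ := pow_sub_dvd_iterate_derivative_pow ((X - C p) * (X - C q)) n j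
  rw [rodriguesBase, hr, eval_mul, eval_pow]
  have : ((X - C p) * (X - C q)).eval t = 0 := by
    rcases ht with rfl | rfl <;> simp
  rw [this, zero_pow (by omega), zero_mul]

lemma natDegree_rodriguesBase (p q : ℝ) (n : ℕ) : (rodriguesBase p q n).natDegree = 2 * n := by
  rw [rodriguesBase, natDegree_pow, natDegree_mul (X_sub_C_ne_zero p) (X_sub_C_ne_zero q)]
  simp
  ring

lemma natDegree_iterate_derivative_rodriguesBase (p q : ℝ) (n : ℕ) :
    (derivative^[n] (rodriguesBase p q n)).natDegree = n := by
  refine le_antisymm ((natDegree_iterate_derivative _ _).trans ?_) ?_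
  · rw [natDegree_rodriguesBase]; omega
  · refine le_natDegree_of_ne_zero ?_
    rw [coeff_iterate_derivative]
    have h1 : (rodriguesBase p q n).coeff (n + n) = 1 := by
      have : (rodriguesBase p q n).Monic := ((monic_X_sub_C p).mul (monic_X_sub_C q)).pow n
      have h := this.coeff_natDegree
      rwa [natDegree_rodriguesBase, two_mul] at h
    rw [h1]
    simp only [nsmul_eq_mul, mul_one, ne_eq, Nat.cast_eq_zero]
    rw [Nat.descFactorial_eq_zero_iff_lt]
    omega

lemma rodriguesBase_recurrence (p q : ℝ) (n j : ℕ) :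
    (X - C p) * (X - C q) * derivative^[j + 2] (rodriguesBase p q n)
      = C (n - (j + 1) : ℝ) * (2 * X - C p - C q) * derivative^[j + 1] (rodriguesBase p q n)
        + C ((j + 1) * (2 * n - j) : ℝ) * derivative^[j] (rodriguesBase p q n) := by
  induction j with
  | zero =>
    have h0 : (X - C p) * (X - C q) * derivative (rodriguesBase p q n)
        = C (n : ℝ) * (2 * X - C p - C q) * rodriguesBase p q n := by
      rcases n with _ | n
      · simp [rodriguesBase]
      · simp only [rodriguesBase, derivative_pow, derivative_mul, derivative_sub, derivative_X,
          derivative_C, Nat.add_sub_cancel]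
        ring
    have h1 := congrArg derivative h0
    simp only [derivative_mul, derivative_sub, derivative_X, derivative_C, derivative_ofNat] at h1
    simp only [Function.iterate_succ, Function.iterate_zero, Function.comp, id, Nat.cast_zero,
      zero_add, sub_zero, one_mul, map_sub, map_mul, map_one, map_ofNat] at h1 ⊢
    linear_combination h1
  | succ j ih =>
    have h1 := congrArg derivative ih
    simp only [derivative_mul, derivative_sub, derivative_add, derivative_X, derivative_C,
      derivative_ofNat, ← Function.iterate_succ_apply' derivative] at h1
    simp only [map_sub, map_add, map_mul, map_one, map_ofNat, Nat.cast_succ] at h1 ⊢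
    linear_combination h1

/-- The double antiderivative of the Legendre polynomial vanishes at the interior zeros of its
second derivative. -/
lemma eval_rodriguesBase_eq_zero {p q : ℝ} {n : ℕ} (hn : 2 ≤ n) {t : ℝ}
    (h : (derivative^[n + 2] (rodriguesBase p q n)).eval t = 0) :
    (derivative^[n - 2] (rodriguesBase p q n)).eval t = 0 := by
  obtain ⟨m, rfl⟩ := Nat.exists_eq_add_of_le' hn
  have h0 := congrArg (eval t) (rodriguesBase_recurrence p q (m + 2) m)
  have h1 := congrArg (eval t) (rodriguesBase_recurrence p q (m + 2) (m + 1))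
  have h2 := congrArg (eval t) (rodriguesBase_recurrence p q (m + 2) (m + 2))
  simp only [eval_mul, eval_add, eval_sub, eval_X, eval_C, eval_ofNat, Nat.cast_add,
    Nat.cast_one, Nat.cast_ofNat, h, show m + 2 - 2 = m from rfl, show m + 1 + 2 = m + 3 from rfl,
    show m + 1 + 1 = m + 2 from rfl] at h0 h1 h2 ⊢
  set w := (t - p) * (t - q)
  set v := 2 * t - p - q
  set y0 := eval t (derivative^[m] (rodriguesBase p q (m + 2)))
  set y1 := eval t (derivative^[m + 1] (rodriguesBase p q (m + 2)))
  set y2 := eval t (derivative^[m + 2] (rodriguesBase p q (m + 2)))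
  set y3 := eval t (derivative^[m + 3] (rodriguesBase p q (m + 2)))
  have key : ((m : ℝ) + 2) * (m + 3) * (m + 1) * (m + 4) * y0 = 0 := by
    linear_combination (-(m + 2 : ℝ) * (m + 3)) * h0 + v * h1 - w * h2
  have : ((m : ℝ) + 2) * (m + 3) * (m + 1) * (m + 4) ≠ 0 := by positivity
  exact (mul_eq_zero.1 key).resolve_left this

lemma integral_iterate_derivative_rodriguesBase_mul (p q : ℝ) (n : ℕ) {Q : ℝ[X]} {j : ℕ}
    (hj : j ≤ n) (hQ : Q.natDegree < j) :
    ∫ t in p..q, (derivative^[j] (rodriguesBase p q n)).eval t * Q.eval t = 0 := by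
  induction j generalizing Q with
  | zero => omega
  | succ j ih =>
    have hint : ∀ R : ℝ[X], IntervalIntegrable (fun t => R.eval t) MeasureTheory.volume p q :=
      fun R => R.continuous.intervalIntegrable _ _
    have h := intervalIntegral.integral_deriv_mul_eq_sub
      (u := fun t => (derivative^[j] (rodriguesBase p q n)).eval t)
      (v := fun t => Q.eval t) (a := p) (b := q)
      (fun t _ => Polynomial.hasDerivAt _ t) (fun t _ => Polynomial.hasDerivAt _ t)
      (hint _) (hint _)
    simp only [eval_iterate_derivative_rodriguesBase (show j < n by omega) (Or.inl rfl),
      eval_iterate_derivative_rodriguesBase (show j < n by omega) (Or.inr rfl), zero_mul,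
      sub_zero, ← Function.iterate_succ_apply' derivative] at h
    rw [intervalIntegral.integral_add] at h
    · rw [← h]
      rcases Nat.eq_zero_or_pos j with rfl | hj0
      · rw [natDegree_eq_zero.1 (by omega : Q.natDegree = 0) |>.choose_spec.symm]
        simp
      · rw [ih (Q := derivative Q) (by omega) (by have := natDegree_derivative_le Q; omega), add_zero]
    · exact (Continuous.mul (Polynomial.continuous _) (Polynomial.continuous _)).intervalIntegrable _ _
    · exact (Continuous.mul (Polynomial.continuous _) (Polynomial.continuous _)).intervalIntegrable _ _

lemma integral_sub_mul_iterate_derivative_rodriguesBase (p q y : ℝ) {n : ℕ} (hn : 2 ≤ n) :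
    ∫ t in p..y, (y - t) * (derivative^[n] (rodriguesBase p q n)).eval t
      = (derivative^[n - 2] (rodriguesBase p q n)).eval y := by
  obtain ⟨m, rfl⟩ := Nat.exists_eq_add_of_le' hn
  have hd : ∀ t ∈ Set.uIcc p y, HasDerivAt
      (fun t => (y - t) * (derivative^[m + 1] (rodriguesBase p q (m + 2))).eval t
        + (derivative^[m] (rodriguesBase p q (m + 2))).eval t)
      ((y - t) * (derivative^[m + 2] (rodriguesBase p q (m + 2))).eval t) t := by
    intro t _
    have h1 := ((hasDerivAt_id t).const_sub y).mul
      (Polynomial.hasDerivAt (derivative^[m + 1] (rodriguesBase p q (m + 2))) t)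
    have h2 := h1.add (Polynomial.hasDerivAt (derivative^[m] (rodriguesBase p q (m + 2))) t)
    simp only [← Function.iterate_succ_apply' derivative] at h2
    convert! h2 using 1
    simp only [id]
    ring
  rw [intervalIntegral.integral_eq_sub_of_hasDerivAt hd
    ((Continuous.mul (by fun_prop) (Polynomial.continuous _)).intervalIntegrable _ _)]
  simp only [Nat.add_sub_cancel, sub_self, zero_mul, mul_zero, add_zero, zero_add, sub_zero,
    eval_iterate_derivative_rodriguesBase (p := p) (q := q) (show m < m + 2 by omega) (Or.inl rfl),
    eval_iterate_derivative_rodriguesBase (p := p) (q := q) (show m + 1 < m + 2 by omega) (Or.inl rfl)]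

lemma iteratedDeriv_polynomial_eval (Q : ℝ[X]) (m : ℕ) :
    iteratedDeriv m (fun t => Q.eval t) = fun t => (derivative^[m] Q).eval t := by
  induction m generalizing Q with
  | zero => simp
  | succ m ih =>
    rw [iteratedDeriv_succ', Function.iterate_succ_apply, ← ih]
    congr 1
    ext t
    exact Polynomial.deriv Q

lemma iteratedDeriv_two_legendre (n : ℕ) (s : ℝ) :
    iteratedDeriv 2 (legendre n) s = 1 / ((2 : ℝ) ^ n * n.factorial) *
      (derivative^[n + 2] (rodriguesBase (-1) 1 n)).eval s := by
  have h : legendre n = fun s => (C (1 / ((2 : ℝ) ^ n * n.factorial)) *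
      derivative^[n] (rodriguesBase (-1) 1 n)).eval s := by
    ext s
    have : (fun t : ℝ => (t ^ 2 - 1) ^ n) = fun t => (rodriguesBase (-1) 1 n).eval t := by
      ext t
      simp only [rodriguesBase, eval_pow, eval_mul, eval_sub, eval_X, eval_C]
      ring
    rw [legendre, this, iteratedDeriv_polynomial_eval, eval_mul, eval_C]
  rw [h, iteratedDeriv_polynomial_eval, iterate_derivative_C_mul]
  simp only []
  rw [eval_mul, eval_C,
    ← Function.iterate_add_apply, Nat.add_comm 2 n]

lemma iterate_derivative_comp_linear (Q : ℝ[X]) (r e : ℝ) (m : ℕ) :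
    derivative^[m] (Q.comp (C r * X + C e)) = C (r ^ m) * (derivative^[m] Q).comp (C r * X + C e) := by
  induction m with
  | zero => simp
  | succ m ih =>
    rw [Function.iterate_succ_apply', ih, Function.iterate_succ_apply', derivative_C_mul,
      derivative_comp]
    simp only [derivative_add, derivative_mul, derivative_C, derivative_X, pow_succ, C_mul]
    ring

lemma eval_rodriguesBase_affMap {p q : ℝ} (hpq : p < q) {n : ℕ} {s : ℝ}
    (hs : iteratedDeriv 2 (legendre n) s = 0) :
    (derivative^[n + 2] (rodriguesBase p q n)).eval (affMap p q s) = 0 := by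
  have hr : (q - p) / 2 ≠ 0 := by linarith [hpq] |> fun h : 0 < (q - p) / 2 => h.ne'
  have hcomp : (rodriguesBase p q n).comp (C ((q - p) / 2) * X + C ((p + q) / 2))
      = C (((q - p) / 2) ^ (2 * n)) * rodriguesBase (-1) 1 n := by
    simp only [rodriguesBase, pow_comp, mul_comp, sub_comp, X_comp, C_comp, pow_mul, C_pow,
      ← mul_pow]
    congr 1
    apply Polynomial.funext
    intro t
    simp only [eval_mul, eval_sub, eval_add, eval_X, eval_C, eval_pow]
    ring
  rw [iteratedDeriv_two_legendre] at hs
  have hs' := (mul_eq_zero.1 hs).resolve_left (by positivity)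
  have h := congrArg (fun R => (derivative^[n + 2] R).eval s) hcomp
  simp only [iterate_derivative_comp_linear, iterate_derivative_C_mul, eval_mul, eval_C, hs',
    mul_zero, eval_comp, eval_add, eval_X] at h
  have h2 := (mul_eq_zero.1 h).resolve_left (pow_ne_zero _ hr)
  rw [affMap]
  convert! h2 using 2
  ring

lemma exists_natDegree_sub_C_mul_le {Q R : ℝ[X]} {n : ℕ} (hQ : Q.natDegree ≤ n + 1)
    (hR : R.natDegree = n + 1) : ∃ A : ℝ, (Q - C A * R).natDegree ≤ n := by
  have hc : R.coeff (n + 1) ≠ 0 := by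
    rw [← hR, coeff_natDegree, leadingCoeff_ne_zero]
    rintro rfl
    simp at hR
  refine ⟨Q.coeff (n + 1) / R.coeff (n + 1), natDegree_le_iff_coeff_eq_zero.2 fun i hi => ?_⟩
  rw [coeff_sub, coeff_C_mul]
  rcases Nat.eq_or_lt_of_le (Nat.succ_le_of_lt hi) with h | h
  · subst h
    simp only [Nat.succ_eq_add_one]
    field_simp
    simp
  · have h1 : Q.coeff i = 0 := coeff_eq_zero_of_natDegree_lt (by omega)
    have h2 : R.coeff i = 0 := coeff_eq_zero_of_natDegree_lt (by omega)
    simp [h1, h2]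

end Rodrigues
/-- The constant-coefficient operator `-α g'' + β g' + γ g`. -/
noncomputable def ellipticOp (α β γ : ℝ) (g : ℝ → ℝ) (t : ℝ) : ℝ :=
  -α * iteratedDeriv 2 g t + β * deriv g t + γ * g t

/-- The bilinear concomitant of `g` and the reflected kernel `t ↦ ψ (y - t)`. -/
noncomputable def concomitant (α β : ℝ) (ψ g : ℝ → ℝ) (y t : ℝ) : ℝ :=
  α * ψ (y - t) * deriv g t + (α * deriv ψ (y - t) - β * ψ (y - t)) * g t

lemma continuous_ellipticOp (α β γ : ℝ) {g : ℝ → ℝ} (hg : ContDiff ℝ 2 g) :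
    Continuous (ellipticOp α β γ g) := by
  have h2 : Continuous (iteratedDeriv 2 g) := hg.continuous_iteratedDeriv 2 (by norm_num)
  have h1 : Continuous (deriv g) := hg.continuous_deriv (by norm_num)
  have h0 : Continuous g := hg.continuous
  unfold ellipticOp
  fun_prop

lemma hasDerivAt_deriv_of_contDiff_two {g : ℝ → ℝ} (hg : ContDiff ℝ 2 g) (t : ℝ) :
    HasDerivAt (deriv g) (iteratedDeriv 2 g t) t := by
  have h : ContDiff ℝ 1 (deriv g) := ContDiff.iterate_deriv' 1 1 (by exact_mod_cast hg)
  rw [show iteratedDeriv 2 g = deriv (deriv g) by rw [iteratedDeriv_eq_iterate]; rfl]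
  exact (h.differentiable (by norm_num)).differentiableAt.hasDerivAt

lemma integral_kernel_mul_ellipticOp {α β γ : ℝ} {ψ g : ℝ → ℝ} (hψ : ContDiff ℝ 2 ψ)
    (hode : ∀ z, α * iteratedDeriv 2 ψ z = β * deriv ψ z + γ * ψ z) (hg : ContDiff ℝ 2 g)
    (y p q : ℝ) :
    ∫ t in p..q, ψ (y - t) * ellipticOp α β γ g t
      = concomitant α β ψ g y p - concomitant α β ψ g y q := by
  have hd : ∀ t ∈ Set.uIcc p q, HasDerivAt (fun t => -concomitant α β ψ g y t)
      (ψ (y - t) * ellipticOp α β γ g t) t := by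
    intro t _
    have hs : HasDerivAt (fun t => y - t) (-1) t := by
      simpa using (hasDerivAt_id t).const_sub y
    have hψ1 : HasDerivAt ψ (deriv ψ (y - t)) (y - t) :=
      (hψ.differentiable (by norm_num)).differentiableAt.hasDerivAt
    have a1 := hψ1.comp t hs
    have a2 := (hasDerivAt_deriv_of_contDiff_two hψ (y - t)).comp t hs
    have g1 : HasDerivAt g (deriv g t) t :=
      (hg.differentiable (by norm_num)).differentiableAt.hasDerivAt
    have g2 := hasDerivAt_deriv_of_contDiff_two hg t
    have := (((a1.const_mul α).mul g2).add
      (((a2.const_mul α).sub (a1.const_mul β)).mul g1)).neg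
    convert! this using 1
    simp only [ellipticOp, Function.comp, Pi.sub_apply]
    linear_combination (-g t) * hode (y - t)
  rw [intervalIntegral.integral_eq_sub_of_hasDerivAt hd]
  · ring
  · have := hψ.continuous
    have := continuous_ellipticOp α β γ hg
    exact Continuous.intervalIntegrable (by fun_prop) _ _

lemma exists_initial_value_kernel {α β γ : ℝ} (hα : 0 < α) (hγ : 0 ≤ γ) :
    ∃ φ : ℝ → ℝ, (∀ n : ℕ, ContDiff ℝ n φ) ∧ φ 0 = 0 ∧ deriv φ 0 = 1 ∧
      (∀ z, α * iteratedDeriv 2 φ z = β * deriv φ z + γ * φ z) ∧ ∀ z, 0 < z → 0 < φ z := by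
  have hdisc : 0 ≤ β ^ 2 + 4 * α * γ := by positivity
  have hit : ∀ f : ℝ → ℝ, iteratedDeriv 2 f = deriv (deriv f) := fun f => by
    rw [iteratedDeriv_eq_iterate]; rfl
  rcases hdisc.eq_or_lt with h0 | hpos
  · have hγ0 : γ = 0 := by
      by_contra hne
      have : 0 < γ := lt_of_le_of_ne hγ (Ne.symm hne)
      nlinarith [sq_nonneg β, mul_pos hα this]
    have hβ0 : β = 0 := by
      subst hγ0
      simpa using h0.symm
    subst hγ0 hβ0
    refine ⟨fun z => z, fun n => contDiff_id, rfl, by simp, fun z => ?_, fun z hz => hz⟩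
    rw [hit]
    simp
  · set ν := β / (2 * α) with hν
    set μ := Real.sqrt (β ^ 2 + 4 * α * γ) / (2 * α) with hμ
    have hμ0 : 0 < μ := by have := Real.sqrt_pos.2 hpos; positivity
    have hμ2 : μ ^ 2 = (β ^ 2 + 4 * α * γ) / (4 * α ^ 2) := by
      rw [hμ, div_pow, Real.sq_sqrt hdisc]; ring
    have hexp : ∀ z, HasDerivAt (fun z => Real.exp (ν * z)) (ν * Real.exp (ν * z)) z := fun z => by
      simpa [mul_comm] using ((hasDerivAt_id z).const_mul ν).exp
    have hsinh : ∀ z, HasDerivAt (fun z => Real.sinh (μ * z)) (μ * Real.cosh (μ * z)) z := fun z => by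
      simpa [mul_comm] using ((hasDerivAt_id z).const_mul μ).sinh
    have hcosh : ∀ z, HasDerivAt (fun z => Real.cosh (μ * z)) (μ * Real.sinh (μ * z)) z := fun z => by
      simpa [mul_comm] using ((hasDerivAt_id z).const_mul μ).cosh
    have hd1 : deriv (fun z => Real.exp (ν * z) * Real.sinh (μ * z) / μ) = fun z =>
        ν * Real.exp (ν * z) * Real.sinh (μ * z) / μ + Real.exp (ν * z) * Real.cosh (μ * z) := by
      ext z
      refine (((hexp z).mul (hsinh z)).div_const μ).deriv.trans ?_
      field_simp
    have hd2 : ∀ z, deriv (fun z => ν * Real.exp (ν * z) * Real.sinh (μ * z) / μ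
        + Real.exp (ν * z) * Real.cosh (μ * z)) z
        = ν ^ 2 * Real.exp (ν * z) * Real.sinh (μ * z) / μ
          + 2 * ν * Real.exp (ν * z) * Real.cosh (μ * z)
          + μ * Real.exp (ν * z) * Real.sinh (μ * z) := by
      intro z
      refine (((((hexp z).const_mul ν).mul (hsinh z)).div_const μ).add
        ((hexp z).mul (hcosh z))).deriv.trans ?_
      field_simp
      ring
    refine ⟨fun z => Real.exp (ν * z) * Real.sinh (μ * z) / μ, fun n => ?_, by simp, ?_, fun z => ?_,
      fun z hz => ?_⟩
    · fun_prop
    · rw [hd1]; simp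
    · rw [hit, hd1, hd2]
      have e1 : 2 * α * ν = β := by rw [hν]; field_simp
      have e2 : α * (ν ^ 2 + μ ^ 2) = β * ν + γ := by
        rw [hμ2, hν]; field_simp; ring
      have e3 : α * (ν ^ 2 * Real.exp (ν * z) * Real.sinh (μ * z) / μ
          + 2 * ν * Real.exp (ν * z) * Real.cosh (μ * z)
          + μ * Real.exp (ν * z) * Real.sinh (μ * z))
          = α * (ν ^ 2 + μ ^ 2) * (Real.exp (ν * z) * Real.sinh (μ * z) / μ)
            + (2 * α * ν) * (Real.exp (ν * z) * Real.cosh (μ * z)) := by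
        field_simp
        ring
      rw [e3, e1, e2]
      ring
    · have := Real.sinh_pos_iff.2 (mul_pos hμ0 hz)
      positivity

lemma deriv_kernel_ode {α β γ : ℝ} {φ : ℝ → ℝ} (hφ : ∀ n : ℕ, ContDiff ℝ n φ)
    (hode : ∀ z, α * iteratedDeriv 2 φ z = β * deriv φ z + γ * φ z) (z : ℝ) :
    α * iteratedDeriv 2 (deriv φ) z = β * deriv (deriv φ) z + γ * deriv φ z := by
  have h2 : ContDiff ℝ 2 (deriv φ) := ContDiff.iterate_deriv' 2 1 (hφ 3)
  have h1 := (hasDerivAt_deriv_of_contDiff_two (hφ 2) z)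
  have h0 : HasDerivAt φ (deriv φ z) z := ((hφ 1).differentiable (by norm_num)).differentiableAt.hasDerivAt
  have hit : iteratedDeriv 2 φ = deriv (deriv φ) := by rw [iteratedDeriv_eq_iterate]; rfl
  rw [hit] at hode h1
  have h3 := hasDerivAt_deriv_of_contDiff_two h2 z
  have h4 := h3.const_mul α
  rw [show (fun z => α * deriv (deriv φ) z) = fun z => β * deriv φ z + γ * φ z from funext hode] at h4
  exact h4.unique ((h1.const_mul β).add (h0.const_mul γ))

lemma abs_sub_le_of_abs_step_le {N : ℕ} {x : ℕ → ℝ} {F : ℕ → ℝ → ℝ} {D : ℝ}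
    (hmatch : ∀ i ∈ Finset.Icc 1 (N - 1), F i (x i) = F (i + 1) (x i))
    (hstep : ∀ i ∈ Finset.Icc 1 N, |F i (x (i - 1)) - F i (x i)| ≤ D * (x i - x (i - 1)))
    {i : ℕ} (hi : i < N) : |F (i + 1) (x i) - F 1 (x 0)| ≤ D * (x i - x 0) := by
  induction i with
  | zero => simp
  | succ i ih =>
    have h1 := ih (by omega)
    have h2 := hstep (i + 1) (Finset.mem_Icc.2 (by omega))
    rw [← hmatch (i + 1) (Finset.mem_Icc.2 (by omega))]
    simp only [Nat.add_sub_cancel] at h2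
    rw [abs_sub_comm] at h2
    calc |F (i + 1) (x (i + 1)) - F 1 (x 0)|
        ≤ |F (i + 1) (x (i + 1)) - F (i + 1) (x i)| + |F (i + 1) (x i) - F 1 (x 0)| :=
          abs_sub_le _ _ _
      _ ≤ D * (x (i + 1) - x 0) := by linarith

/-- The pieces `e i` on the elements of a mesh form a `C¹` function vanishing at both ends whose
image under `ellipticOp` is orthogonal on each element to polynomials of degree at most `m`. -/
structure IsOrthogonalError (α β γ : ℝ) (m N : ℕ) (x : ℕ → ℝ) (e : ℕ → ℝ → ℝ) : Prop where
  contDiff : ∀ i ∈ Finset.Icc 1 N, ContDiff ℝ 2 (e i)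
  eval_match : ∀ i ∈ Finset.Icc 1 (N - 1), e i (x i) = e (i + 1) (x i)
  deriv_match : ∀ i ∈ Finset.Icc 1 (N - 1), deriv (e i) (x i) = deriv (e (i + 1)) (x i)
  left : e 1 (x 0) = 0
  right : e N (x N) = 0
  orthogonal : ∀ i ∈ Finset.Icc 1 N, ∀ Q : Polynomial ℝ, Q.natDegree ≤ m →
    ∫ t in x (i - 1)..x i, ellipticOp α β γ (e i) t * Q.eval t = 0

lemma IsMesh.le {a b : ℝ} {N : ℕ} {x : ℕ → ℝ} (hx : IsMesh a b N x) {i j : ℕ} (hij : i ≤ j)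
    (hj : j ≤ N) : x i ≤ x j := by
  induction j, hij using Nat.le_induction with
  | base => exact le_rfl
  | succ j hij ih => exact (ih (by omega)).trans (hx.2.2.2 j (by omega)).le

lemma IsMesh.element {a b : ℝ} {N : ℕ} {x : ℕ → ℝ} (hx : IsMesh a b N x) {i : ℕ}
    (hi : i ∈ Finset.Icc 1 N) : a ≤ x (i - 1) ∧ x (i - 1) < x i ∧ x i ≤ b := by
  obtain ⟨h1, h2⟩ := Finset.mem_Icc.1 hi
  refine ⟨?_, ?_, ?_⟩
  · rw [← hx.2.1]; exact hx.le (Nat.zero_le _) (by omega)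
  · have := hx.2.2.2 (i - 1) (by omega)
    rwa [Nat.sub_add_cancel h1] at this
  · rw [← hx.2.2.1]; exact hx.le h2 le_rfl

section Stability

variable {α β γ a b h B K : ℝ} {m n N : ℕ} {x : ℕ → ℝ} {e : ℕ → ℝ → ℝ} {φ ψ : ℝ → ℝ}

lemma IsOrthogonalError.abs_integral_kernel_le (he : IsOrthogonalError α β γ m N x e) (hnm : n ≤ m)
    (hx : IsMesh a b N x) (hsize : ∀ i ∈ Finset.Icc 1 N, x i - x (i - 1) ≤ h) (hh : 0 ≤ h)
    (hB : ∀ i ∈ Finset.Icc 1 N,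
      ∫ t in x (i - 1)..x i, |ellipticOp α β γ (e i) t| ≤ (x i - x (i - 1)) * B)
    (hK0 : 0 ≤ K) (hψ : ContDiff ℝ (n + 1) ψ)
    (hK : ∀ z ∈ Set.Icc (a - b) (b - a), |iteratedDeriv (n + 1) ψ z| ≤ K)
    {y : ℝ} (hy : y ∈ Set.Icc a b) {i : ℕ} (hi : i ∈ Finset.Icc 1 N) :
    |∫ t in x (i - 1)..x i, ψ (y - t) * ellipticOp α β γ (e i) t|
      ≤ K * h ^ (n + 1) * B * (x i - x (i - 1)) := by
  obtain ⟨e1, e2, e3⟩ := hx.element hi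
  have hw : ContDiff ℝ (n + 1) fun t => ψ (y - t) := by fun_prop
  obtain ⟨Q, hQ, happ⟩ := exists_polynomial_approx (h := h) hw (hsize i hi) hK0 (by
    intro t ht
    rw [iteratedDeriv_comp_const_sub]
    simp only [smul_eq_mul, abs_mul, abs_pow, abs_neg, abs_one, one_pow, one_mul]
    exact hK _ ⟨by linarith [ht.1, ht.2, hy.1, hy.2], by linarith [ht.1, ht.2, hy.1, hy.2]⟩)
  have := abs_integral_mul_le_of_orthogonal
    (continuous_ellipticOp α β γ (he.contDiff i hi)) hw.continuous e2.le (by positivity) (hB i hi)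
    (he.orthogonal i hi Q (hQ.trans hnm)) happ
  linarith

lemma IsOrthogonalError.abs_concomitant_sub_le (he : IsOrthogonalError α β γ m N x e) (hnm : n ≤ m)
    (hx : IsMesh a b N x) (hsize : ∀ i ∈ Finset.Icc 1 N, x i - x (i - 1) ≤ h) (hh : 0 ≤ h)
    (hB : ∀ i ∈ Finset.Icc 1 N,
      ∫ t in x (i - 1)..x i, |ellipticOp α β γ (e i) t| ≤ (x i - x (i - 1)) * B)
    (hK0 : 0 ≤ K) (hψ : ∀ n : ℕ, ContDiff ℝ n ψ)
    (hode : ∀ z, α * iteratedDeriv 2 ψ z = β * deriv ψ z + γ * ψ z)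
    (hK : ∀ z ∈ Set.Icc (a - b) (b - a), |iteratedDeriv (n + 1) ψ z| ≤ K)
    {y : ℝ} (hy : y ∈ Set.Icc a b) {i : ℕ} (hi : i < N) :
    |concomitant α β ψ (e (i + 1)) y (x i) - concomitant α β ψ (e 1) y (x 0)|
      ≤ K * h ^ (n + 1) * B * (x i - x 0) := by
  refine abs_sub_le_of_abs_step_le (F := fun i t => concomitant α β ψ (e i) y t)
    (fun i hi => ?_) (fun i hi => ?_) hi
  · simp only [concomitant]
    rw [he.eval_match i hi, he.deriv_match i hi]
  · rw [← integral_kernel_mul_ellipticOp (hψ 2) hode (he.contDiff i hi)]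
    exact he.abs_integral_kernel_le hnm hx hsize hh hB hK0 (by exact_mod_cast hψ (n + 1)) hK hy hi

lemma IsOrthogonalError.abs_deriv_left_le (he : IsOrthogonalError α β γ m N x e) (hnm : n ≤ m)
    (hx : IsMesh a b N x) (hsize : ∀ i ∈ Finset.Icc 1 N, x i - x (i - 1) ≤ h) (hh : 0 ≤ h)
    (hB : ∀ i ∈ Finset.Icc 1 N,
      ∫ t in x (i - 1)..x i, |ellipticOp α β γ (e i) t| ≤ (x i - x (i - 1)) * B)
    (hK0 : 0 ≤ K) (hα : 0 < α) (hφ : ∀ n : ℕ, ContDiff ℝ n φ) (hφ0 : φ 0 = 0)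
    (hode : ∀ z, α * iteratedDeriv 2 φ z = β * deriv φ z + γ * φ z) (hφb : 0 < φ (b - a))
    (hK : ∀ z ∈ Set.Icc (a - b) (b - a), |iteratedDeriv (n + 1) φ z| ≤ K) :
    α * |deriv (e 1) a| ≤ K * h ^ (n + 1) * B * (b - a) / φ (b - a) := by
  obtain ⟨hN, hxa, hxb, -⟩ := id hx
  have hab : a ≤ b := by rw [← hxa, ← hxb]; exact hx.le (Nat.zero_le _) le_rfl
  have hy : b ∈ Set.Icc a b := ⟨hab, le_rfl⟩
  have hNN : N ∈ Finset.Icc 1 N := Finset.mem_Icc.2 ⟨hN, le_rfl⟩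
  have h1 := he.abs_concomitant_sub_le hnm hx hsize hh hB hK0 hφ hode hK hy (i := N - 1) (by omega)
  have h2 := he.abs_integral_kernel_le hnm hx hsize hh hB hK0 (by exact_mod_cast hφ (n + 1)) hK hy hNN
  rw [integral_kernel_mul_ellipticOp (hφ 2) hode (he.contDiff N hNN)] at h2
  rw [Nat.sub_add_cancel hN] at h1
  have h3 : concomitant α β φ (e N) b (x N) = 0 := by
    rw [concomitant, he.right, hxb, sub_self, hφ0]; ring
  have h4 : concomitant α β φ (e 1) b (x 0) = φ (b - a) * (α * deriv (e 1) a) := by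
    rw [concomitant, he.left, hxa]; ring
  rw [h3, sub_zero] at h2
  rw [h4, abs_sub_comm] at h1
  rw [le_div_iff₀ hφb]
  have h5 : |φ (b - a) * (α * deriv (e 1) a)| = α * |deriv (e 1) a| * φ (b - a) := by
    rw [abs_mul, abs_mul, abs_of_pos hφb, abs_of_pos hα]; ring
  rw [← h5]
  have h6 := abs_sub_abs_le_abs_sub (φ (b - a) * (α * deriv (e 1) a))
    (concomitant α β φ (e N) b (x (N - 1)))
  rw [hxb] at h2
  rw [hxa] at h1
  linarith

lemma IsOrthogonalError.abs_concomitant_add_integral_le (he : IsOrthogonalError α β γ m N x e)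
    (hnm : n ≤ m)
    (hx : IsMesh a b N x) (hsize : ∀ i ∈ Finset.Icc 1 N, x i - x (i - 1) ≤ h) (hh : 0 ≤ h)
    (hB0 : 0 ≤ B) (hB : ∀ i ∈ Finset.Icc 1 N,
      ∫ t in x (i - 1)..x i, |ellipticOp α β γ (e i) t| ≤ (x i - x (i - 1)) * B)
    (hK0 : 0 ≤ K) (hα : 0 < α) (hφ : ∀ n : ℕ, ContDiff ℝ n φ) (hφ0 : φ 0 = 0)
    (hode : ∀ z, α * iteratedDeriv 2 φ z = β * deriv φ z + γ * φ z) (hφb : 0 < φ (b - a))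
    (hK : ∀ z ∈ Set.Icc (a - b) (b - a), |iteratedDeriv (n + 1) φ z| ≤ K)
    (hψ : ∀ n : ℕ, ContDiff ℝ n ψ)
    (hodeψ : ∀ z, α * iteratedDeriv 2 ψ z = β * deriv ψ z + γ * ψ z)
    (hKψ : ∀ z ∈ Set.Icc (a - b) (b - a), |iteratedDeriv (n + 1) ψ z| ≤ K)
    (hKψ0 : ∀ z ∈ Set.Icc (a - b) (b - a), |ψ z| ≤ K)
    {i : ℕ} (hi : i ∈ Finset.Icc 1 N) {y : ℝ} (hy : y ∈ Set.Icc (x (i - 1)) (x i)) :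
    |concomitant α β ψ (e i) y y + ∫ t in x (i - 1)..y, ψ (y - t) * ellipticOp α β γ (e i) t|
      ≤ (K / φ (b - a) + 1) * (b - a) * K * (h ^ (n + 1) * B) := by
  obtain ⟨e1, e2, e3⟩ := hx.element hi
  obtain ⟨hi1, hi2⟩ := Finset.mem_Icc.1 hi
  have hyab : y ∈ Set.Icc a b := ⟨e1.trans hy.1, hy.2.trans e3⟩
  have h1 := he.abs_concomitant_sub_le hnm hx hsize hh hB hK0 hψ hodeψ hKψ hyab (i := i - 1)
    (by omega)
  have h2 := he.abs_deriv_left_le hnm hx hsize hh hB hK0 hα hφ hφ0 hode hφb hK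
  rw [Nat.sub_add_cancel hi1] at h1
  rw [integral_kernel_mul_ellipticOp (hψ 2) hodeψ (he.contDiff i hi), add_sub_cancel]
  have h3 : concomitant α β ψ (e 1) y (x 0) = ψ (y - a) * (α * deriv (e 1) a) := by
    rw [concomitant, he.left, hx.2.1]; ring
  have h4 : |concomitant α β ψ (e 1) y (x 0)|
      ≤ K * (K * h ^ (n + 1) * B * (b - a) / φ (b - a)) := by
    rw [h3, abs_mul, abs_mul, abs_of_pos hα]
    gcongr
    exact hKψ0 _ ⟨by linarith [hyab.1, hyab.2], by linarith [hyab.1, hyab.2]⟩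
  have h5 : K * h ^ (n + 1) * B * (x (i - 1) - x 0) ≤ K * h ^ (n + 1) * B * (b - a) := by
    gcongr
    · linarith
    · exact hx.2.1.ge
  have h6 := abs_sub_abs_le_abs_sub (concomitant α β ψ (e i) y (x (i - 1)))
    (concomitant α β ψ (e 1) y (x 0))
  have h7 : (K / φ (b - a) + 1) * (b - a) * K * (h ^ (n + 1) * B)
      = K * (K * h ^ (n + 1) * B * (b - a) / φ (b - a)) + K * h ^ (n + 1) * B * (b - a) := by
    field_simp
  rw [h7]
  linarith

end Stability
lemma contDiff_polynomial_eval (Q : Polynomial ℝ) (n : WithTop ℕ∞) :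
    ContDiff ℝ n fun t => Q.eval t := by
  simpa using Q.contDiff_aeval (𝕜 := ℝ) n

lemma exists_polynomial_approx_ellipticOp {α β γ : ℝ} (hα : 0 < α) {r : ℕ} {u : ℝ → ℝ}
    (hu : ContDiff ℝ (r + 3 : ℕ) u) {P : Polynomial ℝ} (hP : P.natDegree ≤ r + 2)
    {p q h M E : ℝ} (hqh : q - p ≤ h) (hM0 : 0 ≤ M)
    (hM : ∀ t ∈ Set.Ioo p q, |iteratedDeriv (r + 3) u t| ≤ M)
    (hE : ∀ t ∈ Set.Icc p q,
      |u t - P.eval t| ≤ E ∧ |deriv (fun t => u t - P.eval t) t| ≤ E) :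
    ∃ Q : Polynomial ℝ, Q.natDegree ≤ r ∧ ∀ t ∈ Set.Icc p q,
      |ellipticOp α β γ (fun t => u t - P.eval t) t - Q.eval t|
        ≤ α * (M * h ^ (r + 1)) + (|β| + |γ|) * E := by
  have hv : ContDiff ℝ (r + 1) (iteratedDeriv 2 u) := by
    rw [iteratedDeriv_eq_iterate]
    exact_mod_cast ContDiff.iterate_deriv' (r + 1) 2 hu
  have hv' : iteratedDeriv (r + 1) (iteratedDeriv 2 u) = iteratedDeriv (r + 3) u := by
    simp only [iteratedDeriv_eq_iterate, ← Function.iterate_add_apply]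
  obtain ⟨T, hT, happ⟩ := exists_polynomial_approx hv hqh hM0 (by rwa [hv'])
  refine ⟨Polynomial.C α * (Polynomial.derivative^[2] P - T), ?_, fun t ht => ?_⟩
  · refine (Polynomial.natDegree_C_mul_le _ _).trans ((Polynomial.natDegree_sub_le _ _).trans ?_)
    have := Polynomial.natDegree_iterate_derivative P 2
    exact max_le (by omega) hT
  · have h2 : iteratedDeriv 2 (fun t => u t - P.eval t) t
        = iteratedDeriv 2 u t - (Polynomial.derivative^[2] P).eval t := by
      have : ContDiff ℝ 2 u := hu.of_le (by exact_mod_cast (by omega : 2 ≤ r + 3))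
      rw [← congrFun (iteratedDeriv_polynomial_eval P 2) t]
      exact iteratedDeriv_sub this.contDiffAt (contDiff_polynomial_eval P 2).contDiffAt
    have h3 : ellipticOp α β γ (fun t => u t - P.eval t) t
        - (Polynomial.C α * (Polynomial.derivative^[2] P - T)).eval t
        = -(α * (iteratedDeriv 2 u t - T.eval t))
          + β * deriv (fun t => u t - P.eval t) t + γ * (u t - P.eval t) := by
      rw [ellipticOp, h2, Polynomial.eval_mul, Polynomial.eval_C, Polynomial.eval_sub]
      ring
    rw [h3]
    obtain ⟨E0, E1⟩ := hE t ht
    have a1 : |-(α * (iteratedDeriv 2 u t - T.eval t))| ≤ α * (M * h ^ (r + 1)) := by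
      rw [abs_neg, abs_mul, abs_of_pos hα]
      exact mul_le_mul_of_nonneg_left (happ t ht) hα.le
    have a2 : |β * deriv (fun t => u t - P.eval t) t| ≤ |β| * E := by
      rw [abs_mul]; gcongr
    have a3 : |γ * (u t - P.eval t)| ≤ |γ| * E := by
      rw [abs_mul]; gcongr
    refine (abs_add_le _ _).trans ?_
    have := abs_add_le (-(α * (iteratedDeriv 2 u t - T.eval t)))
      (β * deriv (fun t => u t - P.eval t) t)
    linarith

lemma IsPGSol.isOrthogonalError {k N : ℕ} {a b α β γ : ℝ} {x : ℕ → ℝ} {u : ℝ → ℝ}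
    {P : ℕ → Polynomial ℝ} (hx : IsMesh a b N x) (hu : ContDiff ℝ 2 u) (hua : u a = 0)
    (hub : u b = 0)
    (hP : IsPGSol k N x α β γ (fun t => -α * iteratedDeriv 2 u t + β * deriv u t + γ * u t) P) :
    IsOrthogonalError α β γ (k - 2) N x (fun i t => u t - (P i).eval t) := by
  obtain ⟨⟨-, hval, hder, hl, hr⟩, horth⟩ := hP
  have hd : ∀ (R : Polynomial ℝ) (t : ℝ),
      deriv (fun t => u t - R.eval t) t = deriv u t - R.derivative.eval t := fun R t =>
    ((hu.differentiable (by norm_num)).differentiableAt.hasDerivAt.sub (R.hasDerivAt t)).deriv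
  have hdd : ∀ (R : Polynomial ℝ) (t : ℝ), iteratedDeriv 2 (fun t => u t - R.eval t) t
      = iteratedDeriv 2 u t - (R.derivative.derivative).eval t := fun R t => by
    have h := congrFun (iteratedDeriv_polynomial_eval R 2) t
    simp only [Function.iterate_succ, Function.iterate_zero, Function.comp, id] at h
    rw [← h]
    exact iteratedDeriv_sub hu.contDiffAt (contDiff_polynomial_eval R 2).contDiffAt
  refine ⟨fun i _ => hu.sub (contDiff_polynomial_eval _ 2), fun i hi => ?_, fun i hi => ?_, ?_, ?_,
    fun i hi Q hQ => ?_⟩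
  · simp only [hval i hi]
  · rw [hd, hd, hder i hi]
  · rw [hl, hx.2.1, hua, sub_zero]
  · rw [hr, hx.2.2.1, hub, sub_zero]
  · have h := horth (fun j => if j = i then Q else 0) (fun j _ => by split_ifs <;> simp [hQ])
    rw [Finset.sum_eq_single_of_mem i hi (fun j _ hj => by simp [hj]),
      Finset.sum_eq_single_of_mem i hi (fun j _ hj => by simp [hj])] at h
    simp only [if_true] at h
    have c1 := continuous_ellipticOp α β γ hu
    have c2 : Continuous fun t => (-α * ((P i).derivative.derivative.eval t)
        + β * ((P i).derivative.eval t) + γ * (P i).eval t) := by fun_prop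
    have c3 : Continuous fun t => Q.eval t := Q.continuous
    have h1 : ∀ t, ellipticOp α β γ (fun t => u t - (P i).eval t) t * Q.eval t
        = ellipticOp α β γ u t * Q.eval t - (-α * ((P i).derivative.derivative.eval t)
        + β * ((P i).derivative.eval t) + γ * (P i).eval t) * Q.eval t := fun t => by
      simp only [ellipticOp, hd, hdd]
      ring
    simp only [h1]
    rw [intervalIntegral.integral_sub (Continuous.intervalIntegrable (by fun_prop) _ _)
      (Continuous.intervalIntegrable (by fun_prop) _ _), h]
    exact sub_self _

lemma exists_isGreatest_abs_add_abs_deriv {a b : ℝ} {N : ℕ} {x : ℕ → ℝ} (hx : IsMesh a b N x)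
    {e : ℕ → ℝ → ℝ} (he : ∀ i ∈ Finset.Icc 1 N, ContDiff ℝ 2 (e i)) :
    ∃ i ∈ Finset.Icc 1 N, ∃ y ∈ Set.Icc (x (i - 1)) (x i),
      ∀ j ∈ Finset.Icc 1 N, ∀ t ∈ Set.Icc (x (j - 1)) (x j),
        |e j t| + |deriv (e j) t| ≤ |e i y| + |deriv (e i) y| := by
  have h1 : ∀ j : ℕ, ∃ y, j ∈ Finset.Icc 1 N → y ∈ Set.Icc (x (j - 1)) (x j) ∧
      ∀ t ∈ Set.Icc (x (j - 1)) (x j), |e j t| + |deriv (e j) t| ≤ |e j y| + |deriv (e j) y| := by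
    intro j
    by_cases hj : j ∈ Finset.Icc 1 N
    · have hc : Continuous fun t => |e j t| + |deriv (e j) t| :=
        (he j hj).continuous.abs.add ((he j hj).continuous_deriv (by norm_num)).abs
      obtain ⟨y, hy, hmax⟩ := (isCompact_Icc (a := x (j - 1)) (b := x j)).exists_isMaxOn
        (Set.nonempty_Icc.2 (hx.element hj).2.1.le) hc.continuousOn
      exact ⟨y, fun _ => ⟨hy, fun t ht => hmax ht⟩⟩
    · exact ⟨0, fun h => absurd h hj⟩
  choose y hy using h1
  obtain ⟨i, hi, hmax⟩ := Finset.exists_max_image (Finset.Icc 1 N)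
    (fun j => |e j (y j)| + |deriv (e j) (y j)|) ⟨1, Finset.mem_Icc.2 ⟨le_rfl, hx.1⟩⟩
  exact ⟨i, hi, y i, (hy i hi).1, fun j hj t ht => ((hy j hj).2 t ht).trans (hmax j hj)⟩

lemma exists_bound_iteratedDeriv {φ : ℝ → ℝ} (hφ : ∀ n : ℕ, ContDiff ℝ n φ) (d : ℝ) :
    ∃ K, 0 < K ∧ ∀ j ≤ 3, ∀ z ∈ Set.Icc (-d) d, |iteratedDeriv j φ z| ≤ K := by
  have h : ∀ j : ℕ, ∃ K, ∀ z ∈ Set.Icc (-d) d, ‖iteratedDeriv j φ z‖ ≤ K := fun j =>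
    isCompact_Icc.exists_bound_of_continuousOn
      ((hφ j).continuous_iteratedDeriv j le_rfl).continuousOn
  choose K hK using h
  refine ⟨1 + ∑ j ∈ Finset.range 4, |K j|, by positivity, fun j hj z hz => ?_⟩
  have h1 : |K j| ≤ ∑ j ∈ Finset.range 4, |K j| :=
    Finset.single_le_sum (f := fun j => |K j|) (fun _ _ => abs_nonneg _)
      (Finset.mem_range.2 (by omega))
  have h2 := hK j z hz
  rw [Real.norm_eq_abs] at h2
  linarith [le_abs_self (K j)]

/-- The contribution of the element containing an interior Jacobi point `y` is of higher order,
because the leading part of the residual is a multiple of the Legendre polynomial. -/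
lemma abs_integral_kernel_mul_le_of_jacobi {φ g : ℝ → ℝ} {r : ℕ} (hφ : ContDiff ℝ 2 φ)
    (hφ0 : φ 0 = 0)
    (hφ1 : deriv φ 0 = 1) {p q h K B B' d : ℝ} (hpq : p ≤ q) (hqh : q - p ≤ h) (hqd : q - p ≤ d)
    (hK0 : 0 ≤ K)
    (hK : ∀ z ∈ Set.Icc (-d) d, |iteratedDeriv 2 φ z| ≤ K) (hg : Continuous g)
    (hgB : ∫ t in p..q, |g t| ≤ (q - p) * B) (hB0 : 0 ≤ B) (hB' : 0 ≤ B')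
    (horth : ∀ Q : Polynomial ℝ, Q.natDegree ≤ r + 1 → ∫ t in p..q, g t * Q.eval t = 0)
    {Q : Polynomial ℝ} (hQ : Q.natDegree ≤ r + 2)
    (happ : ∀ t ∈ Set.Icc p q, |g t - Q.eval t| ≤ B') {y : ℝ} (hy : y ∈ Set.Icc p q)
    (hjac : (Polynomial.derivative^[r] (rodriguesBase p q (r + 2))).eval y = 0) :
    |∫ t in p..y, φ (y - t) * g t| ≤ K * (h ^ 3 * B) + h ^ 2 * B' := by
  set ℓ := Polynomial.derivative^[r + 2] (rodriguesBase p q (r + 2)) with hℓ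
  have hℓc : Continuous fun t => ℓ.eval t := ℓ.continuous
  obtain ⟨A, hA⟩ := exists_natDegree_sub_C_mul_le hQ
    (natDegree_iterate_derivative_rodriguesBase p q (r + 2))
  rw [← hℓ] at hA
  have hh : 0 ≤ h := by linarith
  have hmono : ∀ f : ℝ → ℝ, Continuous f → ∫ t in p..y, |f t| ≤ ∫ t in p..q, |f t| := fun f hf =>
    intervalIntegral.integral_mono_interval le_rfl hy.1 hy.2
      (Filter.Eventually.of_forall fun t => abs_nonneg _) (hf.abs.intervalIntegrable _ _)
  set σ : ℝ → ℝ := fun t => g t - A * ℓ.eval t with hσ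
  have hσc : Continuous σ := by fun_prop
  have hσorth : ∫ t in p..q, σ t * (Q - Polynomial.C A * ℓ).eval t = 0 := by
    have c : Continuous fun t => (Q - Polynomial.C A * ℓ).eval t := Polynomial.continuous _
    have h1 : ∀ t, σ t * (Q - Polynomial.C A * ℓ).eval t
        = g t * (Q - Polynomial.C A * ℓ).eval t
          - A * (ℓ.eval t * (Q - Polynomial.C A * ℓ).eval t) := fun t => by
      simp only [hσ]; ring
    simp only [h1]
    rw [intervalIntegral.integral_sub (Continuous.intervalIntegrable (by fun_prop) _ _)
      (Continuous.intervalIntegrable (by fun_prop) _ _), intervalIntegral.integral_const_mul,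
      horth _ hA, integral_iterate_derivative_rodriguesBase_mul p q (r + 2) le_rfl (by omega)]
    ring
  have hσB : ∫ t in p..q, |σ t| ≤ (q - p) * B' := by
    refine integral_abs_le_of_orthogonal hσc hpq hB' hσorth fun t ht => ?_
    simp only [hσ, Polynomial.eval_sub, Polynomial.eval_mul, Polynomial.eval_C]
    convert! happ t ht using 2
    ring
  have hlin : |∫ t in p..y, (y - t) * σ t| ≤ h ^ 2 * B' := by
    have := abs_integral_mul_le_of_integral_abs_le (w := fun t => y - t) hσc (by fun_prop) hy.1 hh
      ((hmono σ hσc).trans hσB) (fun t ht => by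
        rw [abs_of_nonneg (by linarith [ht.2])]
        linarith [ht.1, hy.2])
    refine this.trans ?_
    rw [pow_two, mul_assoc]
    gcongr
  have hrem : |∫ t in p..y, (φ (y - t) - (y - t)) * g t| ≤ K * (h ^ 3 * B) := by
    have := abs_integral_mul_le_of_integral_abs_le (w := fun t => φ (y - t) - (y - t)) hg
      (by have := hφ.continuous; fun_prop) hy.1 (ε := K * h ^ 2) (by positivity)
      ((hmono g hg).trans hgB) (fun t ht => by
        have h1 := abs_sub_taylor_sum_le (f := φ) (n := 1) (p := 0) (q := d) (K := K)
          (by exact_mod_cast hφ) (fun z hz => hK z ⟨by linarith [hz.1, hz.2], hz.2.le⟩)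
          (t := y - t) ⟨by linarith [ht.2], by linarith [ht.1, hy.2]⟩
        simp only [Finset.sum_range_succ, Finset.sum_range_zero, iteratedDeriv_zero, hφ0,
          iteratedDeriv_one, hφ1, sub_zero] at h1
        simp only [Nat.factorial, pow_one, zero_mul, zero_add, Nat.cast_one, mul_one,
          div_one, one_mul] at h1
        refine h1.trans ?_
        have h2 : y - t ≤ h := by linarith [ht.1, hy.2]
        have h3 : 0 ≤ y - t := by linarith [ht.2]
        have : (y - t) ^ (1 + 1) ≤ h ^ 2 := pow_le_pow_left₀ h3 h2 2
        gcongr)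
    refine this.trans ?_
    have h4 : K * (h ^ 3 * B) = K * h ^ 2 * (h * B) := by ring
    rw [h4]
    gcongr
  have hsplit : ∫ t in p..y, φ (y - t) * g t
      = (∫ t in p..y, (φ (y - t) - (y - t)) * g t) + ∫ t in p..y, (y - t) * σ t := by
    have hJ : ∫ t in p..y, A * ((y - t) * ℓ.eval t) = 0 := by
      rw [intervalIntegral.integral_const_mul, hℓ,
        integral_sub_mul_iterate_derivative_rodriguesBase p q y (by omega)]
      simp only [Nat.add_sub_cancel, hjac, mul_zero]
    have hφc := hφ.continuous
    rw [← add_zero (∫ t in p..y, (y - t) * σ t), ← hJ,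
      ← intervalIntegral.integral_add (Continuous.intervalIntegrable (by fun_prop) _ _)
        (Continuous.intervalIntegrable (by fun_prop) _ _),
      ← intervalIntegral.integral_add (Continuous.intervalIntegrable (by fun_prop) _ _)
        (Continuous.intervalIntegrable (by fun_prop) _ _)]
    refine intervalIntegral.integral_congr fun t _ => ?_
    simp only [hσ]
    ring
  rw [hsplit]
  exact (abs_add_le _ _).trans (add_le_add hrem hlin)

set_option maxHeartbeats 1600000 in
/-- Superconvergence of the Petrov–Galerkin solution at the interior Jacobi points
(images of the roots of `L_{k-1}''`), for `k ≥ 4`: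
`|(u - u_h)(l_{im})| ≤ C h^{k+2} ‖u‖_{k+2,∞}`. -/
theorem petrov_galerkin_superconvergence_jacobi_points (k : ℕ) (hk : 4 ≤ k)
    (α β γ c d : ℝ) (hα : 0 < α) (hγ : 0 ≤ γ) (hc : 1 ≤ c) (hd : 0 < d) :
    ∃ C > 0, ∃ h₀ > 0, ∀ (a b : ℝ), b - a = d →
      ∀ (N : ℕ) (x : ℕ → ℝ) (h : ℝ),
        IsMesh a b N x → IsMeshSize N x h → IsQuasiUniform N x h c → h ≤ h₀ →
      ∀ u : ℝ → ℝ, ContDiff ℝ (k + 2) u → u a = 0 → u b = 0 →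
      ∀ P : ℕ → Polynomial ℝ,
        IsPGSol k N x α β γ (fun t => -α * iteratedDeriv 2 u t + β * deriv u t + γ * u t) P →
      ∀ M : ℝ, (∀ j ≤ k + 2, ∀ y ∈ Set.Ioo a b, |iteratedDeriv j u y| ≤ M) →
        ∀ i ∈ Finset.Icc 1 N, ∀ s ∈ Set.Ioo (-1 : ℝ) 1, iteratedDeriv 2 (legendre (k - 1)) s = 0 →
          |u (affMap (x (i - 1)) (x i) s) - (P i).eval (affMap (x (i - 1)) (x i) s)|
            ≤ C * h ^ (k + 2) * M := by
  obtain ⟨r, rfl⟩ := Nat.exists_eq_add_of_le' hk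
  obtain ⟨φ, hφ, hφ0, hφ1, hode, hφpos⟩ := exists_initial_value_kernel (β := β) hα hγ
  obtain ⟨K, hK0, hK⟩ := exists_bound_iteratedDeriv hφ d
  have hφd := hφpos d hd
  set G := (K / φ d + 1) * d * K with hG
  have hG0 : 0 < G := by positivity
  set S := |β| + |γ| with hS
  have hS0 : 0 ≤ S := by positivity
  set G₁ := 2 * ((G + K) / α) with hG₁
  have hG₁0 : 0 < G₁ := by positivity
  set C₁ := α + 2 * S * G₁ * α with hC₁
  have hC₁0 : 0 < C₁ := by positivity
  refine ⟨(G + K + 1) * C₁ / α, by positivity, 1 / (2 * G₁ * S + 1), by positivity, ?_⟩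
  intro a b hab N x h hx hsz _ hh0 u hu hua hub P hP M hM i hi s hs hs2
  have hsize := hsz.1
  have hh : 0 < h := by
    have := hsize i hi
    linarith [(hx.element hi).2.1]
  have hSh : G₁ * S * h ≤ 1 / 2 := by
    rw [le_div_iff₀ (by positivity)] at hh0
    nlinarith
  have hh1 : h ≤ 1 := hh0.trans (by rw [div_le_one (by positivity)]; nlinarith [mul_nonneg hG₁0.le hS0])
  have hM0 : 0 ≤ M := (abs_nonneg _).trans
    (hM 0 (Nat.zero_le _) ((a + b) / 2) ⟨by linarith, by linarith⟩)
  have hu' : ContDiff ℝ (r + 6 : ℕ) u := by exact_mod_cast hu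
  have he := hP.isOrthogonalError hx
    (hu'.of_le (by exact_mod_cast (by omega : 2 ≤ r + 6))) hua hub
  set e : ℕ → ℝ → ℝ := fun i t => u t - (P i).eval t with he_def
  change IsOrthogonalError α β γ (r + 2) N x e at he
  have hdeg : ∀ j ∈ Finset.Icc 1 N, (P j).natDegree ≤ r + 4 := hP.1.1
  obtain ⟨i₀, hi₀, y₀, hy₀, hmax⟩ := exists_isGreatest_abs_add_abs_deriv hx he.contDiff
  set E := |e i₀ y₀| + |deriv (e i₀) y₀| with hE
  have hE0 : 0 ≤ E := by positivity
  have hEbd : ∀ j ∈ Finset.Icc 1 N, ∀ t ∈ Set.Icc (x (j - 1)) (x j),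
      |e j t| ≤ E ∧ |deriv (e j) t| ≤ E := fun j hj t ht => by
    have := hmax j hj t ht
    constructor <;> linarith [abs_nonneg (e j t), abs_nonneg (deriv (e j) t)]
  have happrox : ∀ l : ℕ, l = r + 2 ∨ l = r + 3 → ∀ j ∈ Finset.Icc 1 N,
      ∃ Q : Polynomial ℝ, Q.natDegree ≤ l ∧ ∀ t ∈ Set.Icc (x (j - 1)) (x j),
        |ellipticOp α β γ (e j) t - Q.eval t| ≤ α * (M * h ^ (l + 1)) + S * E := by
    intro l hl j hj
    obtain ⟨e1, e2, e3⟩ := hx.element hj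
    exact exists_polynomial_approx_ellipticOp hα
      (hu'.of_le (by exact_mod_cast (by omega : l + 3 ≤ r + 6)))
      ((hdeg j hj).trans (by omega)) (hsize j hj) hM0
      (fun t ht => hM (l + 3) (by omega) t ⟨e1.trans_lt ht.1, ht.2.trans_le e3⟩) (hEbd j hj)
  have hcont : ∀ j ∈ Finset.Icc 1 N, Continuous (ellipticOp α β γ (e j)) := fun j hj =>
    continuous_ellipticOp α β γ (he.contDiff j hj)
  set B := α * (M * h ^ (r + 3)) + S * E with hB
  have hB0 : 0 ≤ B := by positivity
  have hL1 : ∀ j ∈ Finset.Icc 1 N,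
      ∫ t in x (j - 1)..x j, |ellipticOp α β γ (e j) t| ≤ (x j - x (j - 1)) * B := fun j hj => by
    obtain ⟨Q, hQ, hQa⟩ := happrox (r + 2) (Or.inl rfl) j hj
    exact integral_abs_le_of_orthogonal (hcont j hj) (hx.element hj).2.1.le hB0
      (he.orthogonal j hj Q hQ) hQa
  have hI : Set.Icc (a - b) (b - a) = Set.Icc (-d) d := by rw [← hab, neg_sub]
  have hrep0 : ∀ j ∈ Finset.Icc 1 N, ∀ y ∈ Set.Icc (x (j - 1)) (x j), ∀ ψ : ℝ → ℝ,
      (∀ n : ℕ, ContDiff ℝ n ψ) → (∀ z, α * iteratedDeriv 2 ψ z = β * deriv ψ z + γ * ψ z) →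
      (∀ z ∈ Set.Icc (-d) d, |deriv ψ z| ≤ K) → (∀ z ∈ Set.Icc (-d) d, |ψ z| ≤ K) →
      |concomitant α β ψ (e j) y y| ≤ (G + K) * (h * B) := by
    intro j hj y hy ψ hψ hodeψ hψ1 hψ0
    obtain ⟨e1, e2, e3⟩ := hx.element hj
    have h1 := he.abs_concomitant_add_integral_le (n := 0) (Nat.zero_le _) hx hsize hh.le hB0 hL1
      hK0.le hα hφ hφ0 hode (by rwa [hab]) (by rw [hI]; exact hK 1 (by norm_num)) hψ hodeψ
      (by rw [hI]; simpa using hψ1) (by rwa [hI]) hj hy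
    rw [hab, ← hG, zero_add, pow_one] at h1
    have h2 := abs_integral_mul_le_of_integral_abs_le (w := fun t => ψ (y - t)) (hcont j hj)
      (by have := (hψ 0).continuous; fun_prop) hy.1 hK0.le
      ((intervalIntegral.integral_mono_interval le_rfl hy.1 hy.2
        (Filter.Eventually.of_forall fun t => abs_nonneg _)
        ((hcont j hj).abs.intervalIntegrable _ _)).trans (hL1 j hj))
      (fun t ht => hψ0 _ ⟨by linarith [ht.2], by linarith [ht.1, hy.2]⟩)
    have h3 : K * ((x j - x (j - 1)) * B) ≤ K * (h * B) := by
      have := hsize j hj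
      gcongr
    have h4 := abs_sub_abs_le_abs_add (concomitant α β ψ (e j) y y)
      (∫ t in x (j - 1)..y, ψ (y - t) * ellipticOp α β γ (e j) t)
    linarith
  have hφφ : α * iteratedDeriv 2 φ 0 = β := by rw [hode, hφ0, hφ1]; ring
  have hit : iteratedDeriv 2 φ = deriv (deriv φ) := by rw [iteratedDeriv_eq_iterate]; rfl
  have hconc : ∀ j y, concomitant α β φ (e j) y y = α * e j y := fun j y => by
    rw [concomitant, sub_self, hφ0, hφ1]; ring
  have hconc' : ∀ j y, concomitant α β (deriv φ) (e j) y y = α * deriv (e j) y := fun j y => by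
    rw [concomitant, sub_self, hφ1, ← hit, hφφ]; ring
  have hK_zero : ∀ z ∈ Set.Icc (-d) d, |φ z| ≤ K := by simpa using hK 0 (by norm_num)
  have hK_one : ∀ z ∈ Set.Icc (-d) d, |deriv φ z| ≤ K := by simpa using hK 1 (by norm_num)
  have hK_two : ∀ z ∈ Set.Icc (-d) d, |iteratedDeriv 2 φ z| ≤ K := hK 2 (by norm_num)
  have hEB : E ≤ G₁ * (h * B) := by
    have h1 := hrep0 i₀ hi₀ y₀ hy₀ φ hφ hode hK_one hK_zero
    have h2 := hrep0 i₀ hi₀ y₀ hy₀ (deriv φ) (fun n => ContDiff.iterate_deriv' n 1 (hφ (n + 1)))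
      (deriv_kernel_ode hφ (by exact hode)) (by rwa [← hit]) hK_one
    rw [hconc, abs_mul, abs_of_pos hα, ← le_div_iff₀' hα] at h1
    rw [hconc', abs_mul, abs_of_pos hα, ← le_div_iff₀' hα] at h2
    have h3 : G₁ * (h * B) = (G + K) * (h * B) / α + (G + K) * (h * B) / α := by
      rw [hG₁]; ring
    rw [h3]
    exact add_le_add h1 h2
  have hEh : E ≤ 2 * G₁ * α * (M * h ^ (r + 4)) := by
    have h1 : G₁ * (h * B) = G₁ * α * (M * h ^ (r + 4)) + G₁ * S * h * E := by
      rw [hB]; ring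
    have h2 : G₁ * S * h * E ≤ 1 / 2 * E := by gcongr
    linarith
  have hBh : B ≤ C₁ * (M * h ^ (r + 3)) := by
    have h1 : M * h ^ (r + 4) ≤ M * h ^ (r + 3) := by
      refine mul_le_mul_of_nonneg_left ?_ hM0
      exact pow_le_pow_of_le_one hh.le hh1 (by omega)
    have h2 : S * E ≤ S * (2 * G₁ * α * (M * h ^ (r + 3))) := by
      refine mul_le_mul_of_nonneg_left (hEh.trans ?_) hS0
      gcongr
    calc B ≤ α * (M * h ^ (r + 3)) + S * (2 * G₁ * α * (M * h ^ (r + 3))) := by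
          rw [hB]; linarith
      _ = C₁ * (M * h ^ (r + 3)) := by rw [hC₁]; ring
  have hB'h : α * (M * h ^ (r + 4)) + S * E ≤ C₁ * (M * h ^ (r + 4)) := by
    have h2 := mul_le_mul_of_nonneg_left hEh hS0
    calc α * (M * h ^ (r + 4)) + S * E
        ≤ α * (M * h ^ (r + 4)) + S * (2 * G₁ * α * (M * h ^ (r + 4))) := by linarith
      _ = C₁ * (M * h ^ (r + 4)) := by rw [hC₁]; ring
  obtain ⟨e1, e2, e3⟩ := hx.element hi
  set y := affMap (x (i - 1)) (x i) s with hy_def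
  have hy : y ∈ Set.Icc (x (i - 1)) (x i) := by
    rw [hy_def, affMap]
    constructor <;> nlinarith [hs.1, hs.2]
  have hjac : (Polynomial.derivative^[r + 1] (rodriguesBase (x (i - 1)) (x i) (r + 3))).eval y = 0 :=
    eval_rodriguesBase_eq_zero (n := r + 3) (by omega) (eval_rodriguesBase_affMap e2 hs2)
  obtain ⟨Q, hQ, hQa⟩ := happrox (r + 3) (Or.inr rfl) i hi
  have hloc := abs_integral_kernel_mul_le_of_jacobi (r := r + 1) (hφ 2) hφ0 hφ1 e2.le (hsize i hi)
    (d := d) (by linarith) hK0.le hK_two (hcont i hi) (hL1 i hi) hB0 (by positivity)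
    (he.orthogonal i hi) hQ hQa hy hjac
  have hglob := he.abs_concomitant_add_integral_le (n := 2) (by omega) hx hsize hh.le hB0 hL1
    hK0.le hα hφ hφ0 hode (by rwa [hab]) (by rw [hI]; exact hK 3 le_rfl) hφ hode
    (by rw [hI]; exact hK 3 le_rfl) (by rwa [hI]) hi hy
  rw [hab, ← hG, hconc] at hglob
  have h4 := abs_sub_abs_le_abs_add (α * e i y)
    (∫ t in x (i - 1)..y, φ (y - t) * ellipticOp α β γ (e i) t)
  have h5 : h ^ 3 * B ≤ C₁ * (M * h ^ (r + 6)) := by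
    calc h ^ 3 * B ≤ h ^ 3 * (C₁ * (M * h ^ (r + 3))) := by gcongr
      _ = C₁ * (M * h ^ (r + 6)) := by ring
  have h6 : h ^ 2 * (α * (M * h ^ (r + 4)) + S * E) ≤ C₁ * (M * h ^ (r + 6)) := by
    calc h ^ 2 * (α * (M * h ^ (r + 4)) + S * E) ≤ h ^ 2 * (C₁ * (M * h ^ (r + 4))) := by gcongr
      _ = C₁ * (M * h ^ (r + 6)) := by ring
  have h7 : |α * e i y| ≤ (G + K + 1) * (C₁ * (M * h ^ (r + 6))) := by
    have h8 := mul_le_mul_of_nonneg_left h5 hG0.le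
    have h9 := mul_le_mul_of_nonneg_left h5 hK0.le
    have h10 : h ^ (2 + 1) = h ^ 3 := rfl
    rw [h10] at hglob
    linarith
  rw [abs_mul, abs_of_pos hα, ← le_div_iff₀' hα] at h7
  refine h7.trans_eq ?_
  ring
end
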